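/- arXiv:1108.2418 — 7 statements merged into one kernel-verified Lean document; each statement's English description precedes it below -/
import Mathlib

section
/- For the 2-vertex IFS on the unit interval, the supremum of the density d_u(J) over all nonempty closed intervals J ⊆ [0,1] equals 1/h_u, and 1/h_u ≥ 1; likewise the supremum of d_v(J) over all nonempty closed intervals J ⊆ [0,1] equals 1/h_v, and 1/h_v ≥ 1. -/
open MeasureTheory
open scoped ENNReal NNReal

noncomputable def dens2V (s h : ℝ) (F : Set ℝ) (p q : ℝ) : ℝ :=
  (μH[s] (F ∩ Set.Icc p q)).toReal / (h * (q - p) ^ s)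

/-- The size-`r` Hausdorff premeasure of dimension `s`: covers by sets of diameter at most `r`. -/
noncomputable def hausdorffPre {X : Type*} [EMetricSpace X] (s : ℝ) (r : ℝ≥0∞) : OuterMeasure X :=
  OuterMeasure.mkMetric'.pre (fun t => Metric.ediam t ^ s) r

section Premeasure

variable {X : Type*} [EMetricSpace X]

lemma hausdorffPre_anti (s : ℝ) {r r' : ℝ≥0∞} (h : r ≤ r') (t : Set X) :
    hausdorffPre s r' t ≤ hausdorffPre s r t :=
  OuterMeasure.mkMetric'.mono_pre _ h t

lemma hausdorffPre_le {s : ℝ} {r : ℝ≥0∞} {t : Set X} (h : Metric.ediam t ≤ r) :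
    hausdorffPre s r t ≤ Metric.ediam t ^ s :=
  OuterMeasure.mkMetric'.pre_le h

lemma tendsto_hausdorffPre [MeasurableSpace X] [BorelSpace X] (s : ℝ) (t : Set X) :
    Filter.Tendsto (fun r => hausdorffPre s r t) (nhdsWithin 0 (Set.Ioi 0)) (nhds (μH[s] t)) := by
  have h := OuterMeasure.mkMetric'.tendsto_pre (fun t : Set X => Metric.ediam t ^ s) t
  have e : μH[s] t = OuterMeasure.mkMetric' (fun t : Set X => Metric.ediam t ^ s) t := by
    rw [Measure.hausdorffMeasure, ← Measure.coe_toOuterMeasure, Measure.mkMetric_toOuterMeasure]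
    rfl
  rw [e]
  exact h

lemma hausdorffPre_le_hausdorffMeasure [MeasurableSpace X] [BorelSpace X] (s : ℝ) {r : ℝ≥0∞}
    (hr : 0 < r) (t : Set X) : hausdorffPre s r t ≤ μH[s] t := by
  refine ge_of_tendsto (tendsto_hausdorffPre s t) ?_
  filter_upwards [Ioo_mem_nhdsGT hr] with r' hr'
  exact hausdorffPre_anti s hr'.2.le t

lemma LipschitzWith.hausdorffPre_image_le {K : ℝ≥0} {f : X → X} (hf : LipschitzWith K f)
    (hK : 0 < K) {s : ℝ} (hs : 0 ≤ s) (r : ℝ≥0∞) (t : Set X) :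
    hausdorffPre s (K * r) (f '' t) ≤ ((K ^ s : ℝ≥0) : ℝ≥0∞) * hausdorffPre s r t := by
  have hc0 : ((K ^ s : ℝ≥0) : ℝ≥0∞) ≠ 0 := by
    simpa using (NNReal.rpow_pos hK).ne'
  have key : (((K ^ s : ℝ≥0) : ℝ≥0∞)⁻¹ • OuterMeasure.comap f (hausdorffPre s (K * r))) ≤
      hausdorffPre s r := by
    refine OuterMeasure.mkMetric'.le_pre.2 fun t ht => ?_
    have hd : Metric.ediam (f '' t) ≤ K * Metric.ediam t := hf.ediam_image_le t
    simp only [_root_.smul_apply, OuterMeasure.comap_apply, smul_eq_mul]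
    rw [ENNReal.inv_mul_le_iff hc0 ENNReal.coe_ne_top]
    calc hausdorffPre s (K * r) (f '' t) ≤ Metric.ediam (f '' t) ^ s :=
          hausdorffPre_le (hd.trans (by gcongr))
      _ ≤ (K * Metric.ediam t) ^ s := ENNReal.rpow_le_rpow hd hs
      _ = _ := by
          rw [ENNReal.mul_rpow_of_nonneg _ _ hs, ENNReal.coe_rpow_of_nonneg _ hs]
  have h := key t
  simp only [_root_.smul_apply, OuterMeasure.comap_apply, smul_eq_mul] at h
  rwa [ENNReal.inv_mul_le_iff hc0 ENNReal.coe_ne_top] at h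

/-- For a two-vertex graph-directed system whose dimension matrix has a left eigenvector `(d ^ s, m)`
of eigenvalue `1`, the Hausdorff measure of the first attractor is already computed by covers of
diameter at most `1`. -/
lemma hausdorffMeasure_le_hausdorffPre_one [MeasurableSpace X] [BorelSpace X]
    {a b c d m : ℝ≥0} (ha : 0 < a) (hb : 0 < b) (hc : 0 < c) (hd : 0 < d)
    (ha1 : a < 1) (hb1 : b < 1) (hc1 : c < 1) (hd1 : d < 1)
    {f₁ f₂ f₃ f₄ : X → X} (h₁ : LipschitzWith a f₁) (h₂ : LipschitzWith b f₂)
    (h₃ : LipschitzWith c f₃) (h₄ : LipschitzWith d f₄) {F G : Set X}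
    (hF : F ⊆ f₁ '' F ∪ f₂ '' G) (hG : G ⊆ f₃ '' G ∪ f₄ '' F) {s : ℝ} (hs : 0 ≤ s)
    (hm : a ^ s + m = 1) (hm' : d ^ s * b ^ s + m * c ^ s = m)
    (hGtop : μH[s] G ≠ ∞) :
    μH[s] F ≤ hausdorffPre s 1 F := by
  obtain ⟨ρ, hρ1, haρ, hbρ, hcρ, hdρ⟩ :
      ∃ ρ : ℝ≥0, ρ < 1 ∧ a ≤ ρ ∧ b ≤ ρ ∧ c ≤ ρ ∧ d ≤ ρ :=
    ⟨max (max a b) (max c d), by simp [*], by simp, by simp, by simp, by simp⟩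
  have hρ0 : 0 < ρ := ha.trans_le haρ
  have step {K : ℝ≥0} {f : X → X} (hf : LipschitzWith K f) (hK : 0 < K) (hKρ : K ≤ ρ)
      (r : ℝ≥0∞) (t : Set X) :
      hausdorffPre s (ρ * r) (f '' t) ≤ ((K ^ s : ℝ≥0) : ℝ≥0∞) * hausdorffPre s r t :=
    (hausdorffPre_anti s (by gcongr) _).trans (hf.hausdorffPre_image_le hK hs r t)
  let W : ℝ≥0∞ → ℝ≥0∞ := fun r =>
    ((d ^ s : ℝ≥0) : ℝ≥0∞) * hausdorffPre s r F + (m : ℝ≥0∞) * hausdorffPre s r G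
  have W_step (r : ℝ≥0∞) : W (ρ * r) ≤ W r := by
    have hF' : hausdorffPre s (ρ * r) F ≤ ((a ^ s : ℝ≥0) : ℝ≥0∞) * hausdorffPre s r F +
        ((b ^ s : ℝ≥0) : ℝ≥0∞) * hausdorffPre s r G :=
      ((measure_mono hF).trans (measure_union_le _ _)).trans
        (add_le_add (step h₁ ha haρ r F) (step h₂ hb hbρ r G))
    have hG' : hausdorffPre s (ρ * r) G ≤ ((c ^ s : ℝ≥0) : ℝ≥0∞) * hausdorffPre s r G +
        ((d ^ s : ℝ≥0) : ℝ≥0∞) * hausdorffPre s r F :=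
      ((measure_mono hG).trans (measure_union_le _ _)).trans
        (add_le_add (step h₃ hc hcρ r G) (step h₄ hd hdρ r F))
    have em : ((a ^ s : ℝ≥0) : ℝ≥0∞) + m = 1 := by exact_mod_cast hm
    have em' : ((d ^ s : ℝ≥0) : ℝ≥0∞) * (b ^ s : ℝ≥0) + m * (c ^ s : ℝ≥0) = m := by
      exact_mod_cast hm'
    calc W (ρ * r) ≤ _ := add_le_add (mul_le_mul_right hF' _) (mul_le_mul_right hG' _)
      _ = ((d ^ s : ℝ≥0) : ℝ≥0∞) * (((a ^ s : ℝ≥0) : ℝ≥0∞) + m) * hausdorffPre s r F +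
          (((d ^ s : ℝ≥0) : ℝ≥0∞) * (b ^ s : ℝ≥0) + m * (c ^ s : ℝ≥0)) * hausdorffPre s r G := by
            ring
      _ = W r := by rw [em, em', mul_one]
  have W_pow (n : ℕ) : W ((ρ : ℝ≥0∞) ^ n) ≤ W 1 := by
    induction n with
    | zero => simp
    | succ n ih => rw [pow_succ']; exact (W_step _).trans ih
  have W_anti {r r' : ℝ≥0∞} (h : r ≤ r') : W r' ≤ W r :=
    add_le_add (mul_le_mul_right (hausdorffPre_anti s h F) _)
      (mul_le_mul_right (hausdorffPre_anti s h G) _)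
  have W_le (r : ℝ≥0∞) (hr : 0 < r) : W r ≤ W 1 := by
    obtain ⟨n, hn⟩ := ((ENNReal.tendsto_pow_atTop_nhds_zero_of_lt_one
      (by exact_mod_cast hρ1 : (ρ : ℝ≥0∞) < 1)).eventually_lt_const hr).exists
    exact (W_anti hn.le).trans (W_pow n)
  have lim : ((d ^ s : ℝ≥0) : ℝ≥0∞) * μH[s] F + (m : ℝ≥0∞) * μH[s] G ≤ W 1 := by
    refine le_of_tendsto
      ((ENNReal.Tendsto.const_mul (tendsto_hausdorffPre s F) (Or.inr ENNReal.coe_ne_top)).add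
        (ENNReal.Tendsto.const_mul (tendsto_hausdorffPre s G) (Or.inr ENNReal.coe_ne_top))) ?_
    filter_upwards [self_mem_nhdsWithin] with r hr
    exact W_le r hr
  have lim' : ((d ^ s : ℝ≥0) : ℝ≥0∞) * μH[s] F + (m : ℝ≥0∞) * μH[s] G ≤
      ((d ^ s : ℝ≥0) : ℝ≥0∞) * hausdorffPre s 1 F + (m : ℝ≥0∞) * μH[s] G :=
    lim.trans (add_le_add le_rfl
      (mul_le_mul_right (hausdorffPre_le_hausdorffMeasure s one_pos G) _))
  have h := ENNReal.le_of_add_le_add_right (ENNReal.mul_ne_top ENNReal.coe_ne_top hGtop) lim'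
  rwa [ENNReal.mul_le_mul_iff_right (by simpa using (NNReal.rpow_pos hd).ne')
    ENNReal.coe_ne_top] at h

/-- If covers of diameter at most `r` compute the finite measure `μH[s] F`, then
the diameter bounds the measure of each piece of `F` of diameter at most `r`. -/
lemma hausdorffMeasure_inter_le_ediam [MeasurableSpace X] [BorelSpace X] {s : ℝ} {r : ℝ≥0∞}
    (hr : 0 < r) {F J : Set X} (hF : μH[s] F ≤ hausdorffPre s r F) (htop : μH[s] F ≠ ∞)
    (hJm : MeasurableSet J) (hJ : Metric.ediam J ≤ r) :
    μH[s] (F ∩ J) ≤ Metric.ediam J ^ s := by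
  have h1 : hausdorffPre s r F ≤ Metric.ediam J ^ s + μH[s] (F \ J) := by
    calc hausdorffPre s r F ≤ hausdorffPre s r (J ∪ F \ J) :=
          measure_mono (by rw [Set.union_sdiff_self]; exact Set.subset_union_right)
      _ ≤ hausdorffPre s r J + hausdorffPre s r (F \ J) := measure_union_le _ _
      _ ≤ _ := add_le_add (hausdorffPre_le hJ) (hausdorffPre_le_hausdorffMeasure s hr _)
  have h2 : μH[s] (F ∩ J) + μH[s] (F \ J) = μH[s] F := measure_inter_add_sdiff F hJm
  have h3 : μH[s] (F \ J) ≠ ∞ := ne_top_of_le_ne_top htop (measure_mono Set.sdiff_subset)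
  refine ENNReal.le_of_add_le_add_right h3 ?_
  rw [h2]
  exact hF.trans h1

end Premeasure

/-- A uniform bound `l` on the interval densities of a compact `F ⊆ [0, 1]` with positive
finite measure is at least `1`. -/
lemma one_le_of_hausdorffMeasure_inter_Icc_le {F : Set ℝ} (hF : IsCompact F)
    (hFsub : F ⊆ Set.Icc 0 1) {s : ℝ} (hs : 0 < s) (h0 : μH[s] F ≠ 0) (htop : μH[s] F ≠ ∞)
    {l : ℝ≥0} (hl0 : 0 < l)
    (hl : ∀ p q : ℝ, p ≤ q → 0 ≤ p → q ≤ 1 →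
      μH[s] (F ∩ Set.Icc p q) ≤ l * ENNReal.ofReal (q - p) ^ s) : 1 ≤ l := by
  have hl0' : (l : ℝ≥0∞) ≠ 0 := by exact_mod_cast hl0.ne'
  have key : (l : ℝ≥0∞)⁻¹ • (μH[s] : Measure ℝ).restrict F ≤ μH[s] := by
    refine Measure.le_hausdorffMeasure s _ 1 one_pos fun t _ => ?_
    rw [Measure.smul_apply, smul_eq_mul, Measure.restrict_apply' hF.measurableSet,
      ENNReal.inv_mul_le_iff hl0' ENNReal.coe_ne_top]
    rcases (t ∩ F).eq_empty_or_nonempty with he | hne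
    · simp [he]
    have hbd : Bornology.IsBounded (t ∩ F) := hF.isBounded.subset Set.inter_subset_right
    have hsub : t ∩ F ⊆ Set.Icc 0 1 := Set.inter_subset_right.trans hFsub
    have hbelow := hbd.bddBelow
    have habove := hbd.bddAbove
    calc μH[s] (t ∩ F) ≤ μH[s] (F ∩ Set.Icc (sInf (t ∩ F)) (sSup (t ∩ F))) :=
          measure_mono fun x hx => ⟨hx.2, csInf_le hbelow hx, le_csSup habove hx⟩
      _ ≤ l * ENNReal.ofReal (sSup (t ∩ F) - sInf (t ∩ F)) ^ s :=
          hl _ _ (csInf_le_csSup hne hbelow habove)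
            (le_csInf hne fun x hx => (hsub hx).1) (csSup_le hne fun x hx => (hsub hx).2)
      _ = l * Metric.ediam (t ∩ F) ^ s := by rw [Real.ediam_eq hbd]
      _ ≤ l * Metric.ediam t ^ s := by
          gcongr
          exact Set.inter_subset_left
  have h := key F
  rw [Measure.smul_apply, smul_eq_mul, Measure.restrict_apply_self,
    ENNReal.inv_mul_le_iff hl0' ENNReal.coe_ne_top] at h
  by_contra! hlt
  have h' : (l : ℝ≥0∞) * μH[s] F < 1 * μH[s] F :=
    ENNReal.mul_lt_mul_left h0 htop (by exact_mod_cast hlt)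
  rw [one_mul] at h'
  exact absurd h h'.not_ge

/-- If `(H^s) (F ∩ J) ≤ |J| ^ s` for all intervals `J ⊆ [0, 1]`, the interval densities
of `F` have supremum `1 / h`, where `h ≤ 1` is the Hausdorff measure of `F`. -/
lemma sSup_dens2V_eq {F : Set ℝ} (hF : IsCompact F) (hFsub : F ⊆ Set.Icc 0 1) {s : ℝ}
    (hs : 0 < s) {h : ℝ} (hh : 0 < h) (hhF : μH[s] F = ENNReal.ofReal h)
    (hle : ∀ p q : ℝ, p ≤ q → 0 ≤ p → q ≤ 1 →
      μH[s] (F ∩ Set.Icc p q) ≤ ENNReal.ofReal (q - p) ^ s) :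
    sSup {x : ℝ | ∃ p q : ℝ, p ≤ q ∧ 0 ≤ p ∧ q ≤ 1 ∧ x = dens2V s h F p q} = 1 / h ∧
      1 ≤ 1 / h := by
  have htop : μH[s] F ≠ ∞ := hhF ▸ ENNReal.ofReal_ne_top
  have hpos : μH[s] F ≠ 0 := by rw [hhF]; simpa using hh
  have hinter : F ∩ Set.Icc 0 1 = F := Set.inter_eq_left.2 hFsub
  have hfull : dens2V s h F 0 1 = 1 := by
    simp [dens2V, hinter, hhF, ENNReal.toReal_ofReal hh.le, hh.ne']
  have hh1 : h ≤ 1 := by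
    have := hle 0 1 zero_le_one le_rfl le_rfl
    rw [hinter, hhF] at this
    simpa using this
  refine ⟨IsLUB.csSup_eq ⟨?_, ?_⟩ ⟨_, 0, 1, zero_le_one, le_rfl, le_rfl, rfl⟩,
    (one_le_div hh).2 hh1⟩
  · rintro _ ⟨p, q, hpq, hp, hq, rfl⟩
    have hJ := ENNReal.toReal_mono
      (ENNReal.rpow_ne_top_of_nonneg hs.le ENNReal.ofReal_ne_top) (hle p q hpq hp hq)
    rw [← ENNReal.toReal_rpow, ENNReal.toReal_ofReal (sub_nonneg.2 hpq)] at hJ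
    rcases hpq.eq_or_lt with rfl | hlt
    · simp [dens2V, Real.zero_rpow hs.ne', hh.le]
    · have hlen : 0 < (q - p) ^ s := Real.rpow_pos_of_pos (sub_pos.2 hlt) s
      rw [dens2V, div_le_div_iff₀ (mul_pos hh hlen) hh]
      nlinarith
  · intro x hx
    have hx1 : 1 ≤ x := hx ⟨0, 1, zero_le_one, le_rfl, le_rfl, hfull.symm⟩
    have hxh : 0 < x * h := by positivity
    have hl := one_le_of_hausdorffMeasure_inter_Icc_le hF hFsub hs hpos htop
      (l := (x * h).toNNReal) (by simpa using hxh) fun p q hpq hp hq => by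
        rcases hpq.eq_or_lt with rfl | hlt
        · have := Measure.nullSingletonClass_hausdorff ℝ hs
          simp [measure_mono_null Set.inter_subset_right (measure_singleton p)]
        have hlen : 0 < (q - p) ^ s := Real.rpow_pos_of_pos (sub_pos.2 hlt) s
        have hd : dens2V s h F p q ≤ x := hx ⟨p, q, hpq, hp, hq, rfl⟩
        rw [dens2V, div_le_iff₀ (mul_pos hh hlen), ← mul_assoc] at hd
        have hfin : μH[s] (F ∩ Set.Icc p q) ≠ ∞ :=
          ne_top_of_le_ne_top htop (measure_mono Set.inter_subset_left)
        rw [ENNReal.ofReal_rpow_of_pos (sub_pos.2 hlt)]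
        change _ ≤ ENNReal.ofReal (x * h) * _
        rw [← ENNReal.ofReal_mul hxh.le]
        exact (ENNReal.le_ofReal_iff_toReal_le hfin (by positivity)).2 hd
    rw [div_le_iff₀ hh]
    simpa using hl

lemma lipschitzWith_affine (r : ℝ≥0) (t : ℝ) :
    LipschitzWith r (fun x : ℝ => r * x + t) := by
  refine LipschitzWith.of_dist_le_mul fun x y => le_of_eq ?_
  rw [dist_add_right, Real.dist_eq, Real.dist_eq, ← mul_sub, abs_mul, abs_of_nonneg r.coe_nonneg]

lemma hausdorffMeasure_inter_Icc_le_rpow {a b c d t t' : ℝ}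
    (ha : 0 < a) (hb : 0 < b) (hc : 0 < c) (hd : 0 < d)
    (ha1 : a < 1) (hb1 : b < 1) (hc1 : c < 1) (hd1 : d < 1) {F G : Set ℝ}
    (hF : F = (fun x => a * x) '' F ∪ (fun x => b * x + t) '' G)
    (hG : G = (fun x => c * x) '' G ∪ (fun x => d * x + t') '' F)
    {s : ℝ} (hs : 0 < s) (hdim : (1 - a ^ s) * (1 - c ^ s) = b ^ s * d ^ s)
    (hFtop : μH[s] F ≠ ∞) (hGtop : μH[s] G ≠ ∞) {p q : ℝ} (hp : 0 ≤ p) (hq : q ≤ 1) :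
    μH[s] (F ∩ Set.Icc p q) ≤ ENNReal.ofReal (q - p) ^ s := by
  have hm : 0 ≤ 1 - a ^ s := sub_nonneg.2 (Real.rpow_le_one ha.le ha1.le hs.le)
  lift a to ℝ≥0 using ha.le
  lift b to ℝ≥0 using hb.le
  lift c to ℝ≥0 using hc.le
  lift d to ℝ≥0 using hd.le
  obtain ⟨m, hm_eq⟩ : ∃ m : ℝ≥0, (m : ℝ) = 1 - (a : ℝ) ^ s := ⟨⟨_, hm⟩, rfl⟩
  have key := hausdorffMeasure_le_hausdorffPre_one (m := m)
    (by exact_mod_cast ha) (by exact_mod_cast hb) (by exact_mod_cast hc) (by exact_mod_cast hd)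
    (by exact_mod_cast ha1) (by exact_mod_cast hb1) (by exact_mod_cast hc1)
    (by exact_mod_cast hd1)
    (lipschitzWith_affine a 0) (lipschitzWith_affine b t)
    (lipschitzWith_affine c 0) (lipschitzWith_affine d t')
    (by simpa only [add_zero] using hF.subset) (by simpa only [add_zero] using hG.subset) hs.le
    (by rw [← NNReal.coe_inj]; push_cast; linarith)
    (by rw [← NNReal.coe_inj]; push_cast; rw [hm_eq]; linarith) hGtop
  have h := hausdorffMeasure_inter_le_ediam one_pos key hFtop (J := Set.Icc p q)
    measurableSet_Icc (by
      rw [Real.ediam_Icc, ENNReal.ofReal_le_one]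
      linarith)
  rwa [Real.ediam_Icc] at h

theorem stmt6
    (a gu b c gv d : ℝ)
    (ha : 0 < a) (hgu : 0 < gu) (hb : 0 < b) (hc : 0 < c) (hgv : 0 < gv) (hd : 0 < d)
    (hsum1 : a + gu + b = 1) (hsum2 : c + gv + d = 1)
    (Fu Fv : Set ℝ)
    (hFuc : IsCompact Fu) (hFvc : IsCompact Fv)
    (hFu0 : (0 : ℝ) ∈ Fu) (hFu1 : (1 : ℝ) ∈ Fu) (hFusub : Fu ⊆ Set.Icc 0 1)
    (hFv0 : (0 : ℝ) ∈ Fv) (hFv1 : (1 : ℝ) ∈ Fv) (hFvsub : Fv ⊆ Set.Icc 0 1)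
    (hFu : Fu = (fun x => a * x) '' Fu ∪ (fun x => b * x + (a + gu)) '' Fv)
    (hFv : Fv = (fun x => c * x) '' Fv ∪ (fun x => d * x + (c + gv)) '' Fu)
    (s : ℝ) (hs0 : 0 < s) (hs1 : s < 1)
    (hdim : (1 - a ^ s) * (1 - c ^ s) = b ^ s * d ^ s)
    (hu hv : ℝ) (hhu0 : 0 < hu) (hhv0 : 0 < hv)
    (hhuH : μH[s] Fu = ENNReal.ofReal hu) (hhvH : μH[s] Fv = ENNReal.ofReal hv)
    (heigu : hu = a ^ s * hu + b ^ s * hv)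
    (heigv : hv = d ^ s * hu + c ^ s * hv)
    :
    sSup {x : ℝ | ∃ p q : ℝ, p ≤ q ∧ 0 ≤ p ∧ q ≤ 1 ∧ x = dens2V s hu Fu p q} = 1 / hu ∧
    1 ≤ 1 / hu ∧
    sSup {x : ℝ | ∃ p q : ℝ, p ≤ q ∧ 0 ≤ p ∧ q ≤ 1 ∧ x = dens2V s hv Fv p q} = 1 / hv ∧
    1 ≤ 1 / hv := by
  have hutop : μH[s] Fu ≠ ∞ := hhuH ▸ ENNReal.ofReal_ne_top
  have hvtop : μH[s] Fv ≠ ∞ := hhvH ▸ ENNReal.ofReal_ne_top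
  have ha1 : a < 1 := by linarith
  have hb1 : b < 1 := by linarith
  have hc1 : c < 1 := by linarith
  have hd1 : d < 1 := by linarith
  obtain ⟨hu_sup, hu_le⟩ := sSup_dens2V_eq hFuc hFusub hs0 hhu0 hhuH fun p q _ hp hq =>
    hausdorffMeasure_inter_Icc_le_rpow ha hb hc hd ha1 hb1 hc1 hd1 hFu hFv hs0 hdim
      hutop hvtop hp hq
  obtain ⟨hv_sup, hv_le⟩ := sSup_dens2V_eq hFvc hFvsub hs0 hhv0 hhvH fun p q _ hp hq =>
    hausdorffMeasure_inter_Icc_le_rpow hc hd ha hb hc1 hd1 ha1 hb1 hFv hFu hs0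
      (by linarith) hvtop hutop hp hq
  exact ⟨hu_sup, hu_le, hv_sup, hv_le⟩
end

section
/- Let a, g_u, b, c, g_v, d be positive reals with a + g_u + b = 1 and c + g_v + d = 1, let s ∈ (0,1), and let h_u, h_v be positive reals with h_u = a^s h_u + b^s h_v and h_v = d^s h_u + c^s h_v. Define f_u(x,y) = (x^s + (h_v/h_u)·y^s)/(x + g_u + y)^s and f_v(x,y) = (x^s + (h_u/h_v)·y^s)/(x + g_v + y)^s, and set P = {(x,y) : 0 ≤ x ≤ a, 0 ≤ y ≤ b} \ {(a,b)} and Q = {(x,y) : 0 ≤ x ≤ c, 0 ≤ y ≤ d} \ {(c,d)}. Suppose h_v ≤ h_u and (a + g_u)(1 − a^s) ≥ b·a^s. Then: (a) f_u(a,b) = f_v(c,d) = 1; (b) f_u(x,y) < 1 for all (x,y) ∈ P; (c) f_v(x,y) < 1 for all (x,y) ∈ Q. -/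
open MeasureTheory
open scoped ENNReal NNReal

noncomputable def fU (s gu hu hv : ℝ) (x y : ℝ) : ℝ :=
  (x ^ s + (hv / hu) * y ^ s) / (x + gu + y) ^ s

noncomputable def fV (s gv hu hv : ℝ) (x y : ℝ) : ℝ :=
  (x ^ s + (hu / hv) * y ^ s) / (x + gv + y) ^ s

/-- If the weights of a convex combination of `p ^ s` and `q ^ s` exceed the coefficients of the
affine form `a * p + g + b * q`, then that form raised to the power `s` dominates on the unit
square, strictly so away from the corner `(1, 1)`. -/
theorem convexComb_rpow_lt_rpow {a g b w s p q : ℝ} (hs0 : 0 < s) (hs1 : s < 1)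
    (hsum : a + g + b = 1) (haw : a < w) (hw0 : 0 < w) (hw1 : w < 1) (hbw : b ≤ 1 - w)
    (hp0 : 0 ≤ p) (hp1 : p ≤ 1) (hq0 : 0 ≤ q) (hq1 : q ≤ 1) (hpq : p < 1 ∨ q < 1) :
    w * p ^ s + (1 - w) * q ^ s < (a * p + g + b * q) ^ s := by
  have hconc := Real.strictConcaveOn_rpow hs0 hs1
  have hcomb : 0 ≤ w * p + (1 - w) * q :=
    add_nonneg (mul_nonneg hw0.le hp0) (mul_nonneg (sub_nonneg.2 hw1.le) hq0)
  have hq' : 0 ≤ (1 - w - b) * (1 - q) := mul_nonneg (by linarith) (by linarith)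
  rcases hp1.lt_or_eq with hp | rfl
  · have hjensen := hconc.concaveOn.2 (Set.mem_Ici.2 hp0) (Set.mem_Ici.2 hq0) hw0.le
      (sub_nonneg.2 hw1.le) (by ring)
    simp only [smul_eq_mul] at hjensen
    have hp' : 0 < (w - a) * (1 - p) := mul_pos (by linarith) (by linarith)
    exact hjensen.trans_lt (Real.rpow_lt_rpow hcomb (by linear_combination hp' + hq' - hsum) hs0)
  · have hq : q < 1 := by simpa using hpq
    have hjensen := hconc.2 (Set.mem_Ici.2 hp0) (Set.mem_Ici.2 hq0) hq.ne' hw0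
      (sub_pos.2 hw1) (by ring)
    simp only [smul_eq_mul] at hjensen
    exact hjensen.trans_le (Real.rpow_le_rpow hcomb (by linear_combination hq' - hsum) hs0.le)

theorem rpow_add_mul_rpow_div_lt_one {a g b k s x y : ℝ} (ha : 0 < a) (hg : 0 < g) (hb : 0 < b)
    (hsum : a + g + b = 1) (hs0 : 0 < s) (hs1 : s < 1) (hk : a ^ s + k * b ^ s = 1)
    (hba : b ≤ 1 - a ^ s) (hx0 : 0 ≤ x) (hxa : x ≤ a) (hy0 : 0 ≤ y) (hyb : y ≤ b)
    (hxy : (x, y) ≠ (a, b)) :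
    (x ^ s + k * y ^ s) / (x + g + y) ^ s < 1 := by
  have hpq : x / a < 1 ∨ y / b < 1 := by
    rw [div_lt_one ha, div_lt_one hb]
    by_contra! h
    exact hxy (Prod.ext (le_antisymm hxa h.1) (le_antisymm hyb h.2))
  have key := convexComb_rpow_lt_rpow hs0 hs1 hsum
    (Real.self_lt_rpow_of_lt_one ha (by linarith) hs1) (Real.rpow_pos_of_pos ha s)
    (by linarith) hba (div_nonneg hx0 ha.le) ((div_le_one ha).2 hxa)
    (div_nonneg hy0 hb.le) ((div_le_one hb).2 hyb) hpq
  rw [← hk, add_sub_cancel_left, mul_assoc, ← Real.mul_rpow ha.le (div_nonneg hx0 ha.le),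
    ← Real.mul_rpow hb.le (div_nonneg hy0 hb.le), mul_div_cancel₀ x ha.ne',
    mul_div_cancel₀ y hb.ne'] at key
  rwa [div_lt_one (by positivity)]

theorem stmt7 (a gu b c gv d s hu hv : ℝ)
    (ha : 0 < a) (hgu : 0 < gu) (hb : 0 < b) (hc : 0 < c) (hgv : 0 < gv) (hd : 0 < d)
    (hsum1 : a + gu + b = 1) (hsum2 : c + gv + d = 1)
    (hs0 : 0 < s) (hs1 : s < 1)
    (hhu0 : 0 < hu) (hhv0 : 0 < hv)
    (heigu : hu = a ^ s * hu + b ^ s * hv)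
    (heigv : hv = d ^ s * hu + c ^ s * hv)
    (hcond2 : hv ≤ hu)
    (hcond3 : b * a ^ s ≤ (a + gu) * (1 - a ^ s)) :
    (fU s gu hu hv a b = 1 ∧ fV s gv hu hv c d = 1) ∧
    (∀ x y : ℝ, 0 ≤ x → x ≤ a → 0 ≤ y → y ≤ b → (x, y) ≠ (a, b) →
      fU s gu hu hv x y < 1) ∧
    (∀ x y : ℝ, 0 ≤ x → x ≤ c → 0 ≤ y → y ≤ d → (x, y) ≠ (c, d) →
      fV s gv hu hv x y < 1) := by
  have hku : a ^ s + hv / hu * b ^ s = 1 := by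
    field_simp
    linarith
  have hkv : c ^ s + hu / hv * d ^ s = 1 := by
    field_simp
    linarith
  have hbu : b ≤ 1 - a ^ s := by
    linear_combination hcond3 + (1 - a ^ s) * hsum1
  have hdv : d ≤ 1 - c ^ s := by
    have hds : d ≤ d ^ s := Real.self_le_rpow_of_le_one hd.le (by linarith) hs1.le
    have hle : d ^ s ≤ hu / hv * d ^ s :=
      le_mul_of_one_le_left (by positivity) ((one_le_div hhv0).2 hcond2)
    linarith
  refine ⟨⟨?_, ?_⟩, ?_, ?_⟩
  · rw [fU, hku, hsum1, Real.one_rpow, div_one]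
  · rw [fV, hkv, hsum2, Real.one_rpow, div_one]
  · intro x y hx0 hxa hy0 hyb hxy
    exact rpow_add_mul_rpow_div_lt_one ha hgu hb hsum1 hs0 hs1 hku hbu hx0 hxa hy0 hyb hxy
  · intro x y hx0 hxc hy0 hyd hxy
    exact rpow_add_mul_rpow_div_lt_one hc hgv hd hsum2 hs0 hs1 hkv hdv hx0 hxc hy0 hyd hxy
end

section
/- For the 2-vertex IFS on the unit interval, assume h_v ≤ h_u and (a + g_u)(1 − a^s) ≥ b·a^s. Then: (a) sup{ d_u(J) : J closed interval with [0,a] ⊆ J ⊆ [0,1] } = 1; (b) sup{ d_v(J) : J closed interval with [0,c] ⊆ J ⊆ [0,1] } = 1; (c) sup{ d_u(J) : J closed interval with [a+g_u, 1] ⊆ J ⊆ [0,1] } = 1; (d) sup{ d_v(J) : J closed interval with [c+g_v, 1] ⊆ J ⊆ [0,1] } = h_u/h_v; and in each case the supremum is attained by some interval J. -/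
open MeasureTheory
open scoped ENNReal NNReal

lemma hausdorffMeasure_real_affine_image_le {s k : ℝ} (hs : 0 ≤ s) (hk : 0 ≤ k) (t : ℝ)
    {X : Set ℝ} (hX : μH[s] X ≠ ∞) :
    μH[s] ((fun x => k * x + t) '' X) ≠ ∞ ∧
      (μH[s]).real ((fun x => k * x + t) '' X) ≤ k ^ s * (μH[s]).real X := by
  have hlip : LipschitzWith k.toNNReal (fun x : ℝ => k * x + t) := by
    refine LipschitzWith.of_dist_le_mul fun x y => ?_
    rw [Real.dist_eq, Real.dist_eq, Real.coe_toNNReal k hk,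
      show k * x + t - (k * y + t) = k * (x - y) by ring, abs_mul, abs_of_nonneg hk]
  have hle := hlip.hausdorffMeasure_image_le hs X
  have hfin : (k.toNNReal : ℝ≥0∞) ^ s * μH[s] X ≠ ∞ :=
    ENNReal.mul_ne_top (ENNReal.rpow_ne_top_of_nonneg hs ENNReal.coe_ne_top) hX
  refine ⟨ne_top_of_le_ne_top hfin hle, ?_⟩
  have := ENNReal.toReal_mono hfin hle
  rwa [ENNReal.toReal_mul, ← ENNReal.toReal_rpow, ENNReal.coe_toReal,
    Real.coe_toNNReal k hk] at this

/-- The reflection of a subset of the line about `1 / 2`. -/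
def unitReflect (X : Set ℝ) : Set ℝ := (fun x => 1 - x) ⁻¹' X

lemma hausdorffMeasure_unitReflect (s : ℝ) (X : Set ℝ) : μH[s] (unitReflect X) = μH[s] X :=
  (IsometryEquiv.subLeft (1 : ℝ)).hausdorffMeasure_preimage s X

lemma unitReflect_inter_Icc (X : Set ℝ) (p : ℝ) :
    unitReflect (X ∩ Set.Icc p 1) = unitReflect X ∩ Set.Icc 0 (1 - p) := by
  ext x
  simp only [unitReflect, Set.mem_preimage, Set.mem_inter_iff, Set.mem_Icc]
  constructor <;> rintro ⟨h, h1, h2⟩ <;> exact ⟨h, by linarith, by linarith⟩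

lemma unitReflect_subset {X : Set ℝ} (h : X ⊆ Set.Icc 0 1) : unitReflect X ⊆ Set.Icc 0 1 := by
  intro x hx
  have := h hx
  exact ⟨by linarith [this.2], by linarith [this.1]⟩

lemma unitReflect_eq_union {l g r : ℝ} (hsum : l + g + r = 1) {F X Y : Set ℝ}
    (hF : F = (fun x => l * x) '' X ∪ (fun x => r * x + (l + g)) '' Y) :
    unitReflect F = (fun x => r * x) '' unitReflect Y ∪
      (fun x => l * x + (r + g)) '' unitReflect X := by
  subst hF
  ext x
  simp only [unitReflect, Set.mem_preimage, Set.mem_union, Set.mem_image]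
  constructor
  · rintro (⟨y, hy, h⟩ | ⟨y, hy, h⟩)
    · exact Or.inr ⟨1 - y, by simpa using hy, by linarith⟩
    · exact Or.inl ⟨1 - y, by simpa using hy, by linarith⟩
  · rintro (⟨y, hy, h⟩ | ⟨y, hy, h⟩)
    · exact Or.inr ⟨1 - y, hy, by linarith⟩
    · exact Or.inl ⟨1 - y, hy, by linarith⟩

/-- `H * x ^ s` bounds the Hausdorff measure of `X ∩ [0, x]` up to an error `H * ε`. -/
def InitialBound (s : ℝ) (X : Set ℝ) (H ε : ℝ) : Prop :=
  ∀ x, 0 ≤ x → x ≤ 1 → (μH[s]).real (X ∩ Set.Icc 0 x) ≤ H * (x ^ s + ε)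

lemma InitialBound.union {s l g r : ℝ} (hs0 : 0 < s) (hs1 : s < 1)
    (hl : 0 < l) (hg : 0 < g) (hr : 0 < r) (hsum : l + g + r = 1) {F X Y : Set ℝ}
    (hX : X ⊆ Set.Icc 0 1) (hY : Y ⊆ Set.Icc 0 1)
    (hF : F = (fun x => l * x) '' X ∪ (fun x => r * x + (l + g)) '' Y)
    (hXfin : μH[s] X ≠ ∞) (hYfin : μH[s] Y ≠ ∞)
    {HX HY HF ρ ε : ℝ} (hHF : 0 < HF) (hρ : 0 ≤ ρ) (hε : 0 ≤ ε)
    (hXF : HX ≤ HF) (hm1 : (μH[s]).real X ≤ HF)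
    (hm2 : l ^ s * (μH[s]).real X ≤ HF * (1 - r))
    (hm3 : l ^ s * (μH[s]).real X + r ^ s * HY ≤ HF)
    (hρX : l ^ s * HX ≤ ρ * HF) (hρY : r ^ s * HY ≤ ρ * HF)
    (hbX : InitialBound s X HX ε) (hbY : InitialBound s Y HY ε) :
    InitialBound s F HF (ρ * ε) := by
  intro x hx0 hx1
  have hsub : ∀ {A B : Set ℝ}, A ⊆ B → μH[s] B ≠ ∞ → μH[s] A ≠ ∞ :=
    fun h hB => ne_top_of_le_ne_top hB (measure_mono h)
  have hρε : 0 ≤ HF * (ρ * ε) := by positivity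
  have hls : 0 < l ^ s := Real.rpow_pos_of_pos hl s
  have himX : ∀ A ⊆ X, μH[s] ((fun x => l * x) '' A) ≠ ∞ ∧
      (μH[s]).real ((fun x => l * x) '' A) ≤ l ^ s * (μH[s]).real A := by
    intro A hA
    simpa using hausdorffMeasure_real_affine_image_le hs0.le hl.le 0 (hsub hA hXfin)
  rcases lt_or_ge x (l + g) with hlt | hge
  · have hright : ∀ y ∈ Y, ¬ r * y + (l + g) ≤ x := by
      intro y hy h
      have := mul_nonneg hr.le (hY hy).1
      linarith
    rcases le_total x l with hxl | hxl
    · have hincl : F ∩ Set.Icc 0 x ⊆ (fun x => l * x) '' (X ∩ Set.Icc 0 (x / l)) := by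
        rw [hF]
        rintro z ⟨⟨y, hy, rfl⟩ | ⟨y, hy, rfl⟩, hz0, hz1⟩
        · refine ⟨y, ⟨hy, (hX hy).1, ?_⟩, rfl⟩
          rw [le_div_iff₀ hl]
          linarith
        · exact absurd hz1 (hright y hy)
      obtain ⟨hfin, hle⟩ := himX _ (Set.inter_subset_left : X ∩ Set.Icc 0 (x / l) ⊆ X)
      have h1 := measureReal_mono hincl hfin
      have h2 := hbX (x / l) (by positivity) (by rwa [div_le_one hl])
      rw [Real.div_rpow hx0 hl.le] at h2
      have h3 := mul_le_mul_of_nonneg_left h2 hls.le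
      have h4 : l ^ s * (HX * (x ^ s / l ^ s + ε)) = HX * x ^ s + l ^ s * HX * ε := by
        field_simp
      have h5 := mul_le_mul_of_nonneg_right hXF (Real.rpow_nonneg hx0 s)
      have h6 := mul_le_mul_of_nonneg_right hρX hε
      linarith
    · have hincl : F ∩ Set.Icc 0 x ⊆ (fun x => l * x) '' X := by
        rw [hF]
        rintro z ⟨⟨y, hy, rfl⟩ | ⟨y, hy, rfl⟩, hz0, hz1⟩
        · exact ⟨y, hy, rfl⟩
        · exact absurd hz1 (hright y hy)
      obtain ⟨hfin, hle⟩ := himX X le_rfl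
      have h1 := measureReal_mono hincl hfin
      have h2 := Real.rpow_le_rpow hl.le hxl hs0.le
      have h3 := mul_le_mul_of_nonneg_left h2 hHF.le
      have h4 := mul_le_mul_of_nonneg_left hm1 hls.le
      linarith
  · obtain ⟨t, rfl⟩ : ∃ t, x = l + g + r * t := ⟨(x - (l + g)) / r, by field_simp; ring⟩
    have ht0 : 0 ≤ t := by
      by_contra! h
      nlinarith
    have ht1 : t ≤ 1 := by
      by_contra! h
      nlinarith
    have hincl : F ∩ Set.Icc 0 (l + g + r * t) ⊆ (fun x => l * x) '' X ∪
        (fun x => r * x + (l + g)) '' (Y ∩ Set.Icc 0 t) := by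
      rw [hF]
      rintro z ⟨⟨y, hy, rfl⟩ | ⟨y, hy, rfl⟩, hz0, hz1⟩
      · exact Or.inl ⟨y, hy, rfl⟩
      · refine Or.inr ⟨y, ⟨hy, (hY hy).1, ?_⟩, rfl⟩
        exact le_of_mul_le_mul_left (by linarith) hr
    obtain ⟨hfinX, hleX⟩ := himX X le_rfl
    obtain ⟨hfinY, hleY⟩ := hausdorffMeasure_real_affine_image_le hs0.le hr.le (l + g)
      (hsub (Set.inter_subset_left : Y ∩ Set.Icc 0 t ⊆ Y) hYfin)
    have h1 := measureReal_mono hincl (measure_union_ne_top hfinX hfinY)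
    have h2 := measureReal_union_le (μ := μH[s]) ((fun x => l * x) '' X)
      ((fun x => r * x + (l + g)) '' (Y ∩ Set.Icc 0 t))
    have h3 := mul_le_mul_of_nonneg_left (hbY t ht0 ht1) (Real.rpow_pos_of_pos hr s).le
    have hconc := (Real.concaveOn_rpow hs0.le hs1.le).2 (x := 1) (y := t) (by simp) ht0
      (show (0 : ℝ) ≤ l + g by positivity) hr.le hsum
    simp only [smul_eq_mul, Real.one_rpow, mul_one] at hconc
    have hts1 : t ^ s ≤ 1 := Real.rpow_le_one ht0 ht1 hs0.le
    have hts0 : 0 ≤ t ^ s := Real.rpow_nonneg ht0 s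
    have h4 := mul_le_mul_of_nonneg_left hconc hHF.le
    have h5 := mul_le_mul_of_nonneg_right hρY hε
    have h6 := mul_le_mul_of_nonneg_right hm3 hts0
    have h7 := mul_le_mul_of_nonneg_right hm2 (sub_nonneg.2 hts1)
    have h8 : l + g = 1 - r := by linarith
    rw [h8] at h4 h1 h2 hleY ⊢
    linarith

lemma InitialBound.zero_of_contraction {s : ℝ} {X Y : Set ℝ} {HX HY ρ : ℝ}
    (hXfin : μH[s] X ≠ ∞) (hYfin : μH[s] Y ≠ ∞)
    (hX : (μH[s]).real X ≤ HX) (hY : (μH[s]).real Y ≤ HY) (hρ0 : 0 ≤ ρ) (hρ1 : ρ < 1)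
    (step : ∀ ε, 0 ≤ ε → InitialBound s X HX ε → InitialBound s Y HY ε →
      InitialBound s X HX (ρ * ε) ∧ InitialBound s Y HY (ρ * ε)) :
    InitialBound s X HX 0 ∧ InitialBound s Y HY 0 := by
  have base : ∀ {Z : Set ℝ} {H : ℝ}, μH[s] Z ≠ ∞ → (μH[s]).real Z ≤ H →
      InitialBound s Z H 1 := by
    intro Z H hfin hle x hx0 _
    have h1 := measureReal_mono (Set.inter_subset_left : Z ∩ Set.Icc 0 x ⊆ Z) hfin
    have hH : 0 ≤ H := measureReal_nonneg.trans hle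
    have := mul_nonneg hH (Real.rpow_nonneg hx0 s)
    linarith
  have hpow : ∀ n : ℕ, InitialBound s X HX (ρ ^ n) ∧ InitialBound s Y HY (ρ ^ n) := by
    intro n
    induction n with
    | zero => simpa using ⟨base hXfin hX, base hYfin hY⟩
    | succ n ih =>
      rw [pow_succ']
      exact step _ (pow_nonneg hρ0 n) ih.1 ih.2
  have lim : ∀ {Z : Set ℝ} {H : ℝ}, (∀ n : ℕ, InitialBound s Z H (ρ ^ n)) →
      InitialBound s Z H 0 := by
    intro Z H h x hx0 hx1
    refine ge_of_tendsto' (x := Filter.atTop) ?_ fun n => h n x hx0 hx1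
    exact ((tendsto_pow_atTop_nhds_zero_of_lt_one hρ0 hρ1).const_add _).const_mul _
  exact ⟨lim fun n => (hpow n).1, lim fun n => (hpow n).2⟩

lemma dens2V_zero_left_le {s h : ℝ} (hh : 0 < h) {F : Set ℝ} (hF : InitialBound s F h 0)
    {q : ℝ} (hq0 : 0 < q) (hq1 : q ≤ 1) : dens2V s h F 0 q ≤ 1 := by
  have hqs := Real.rpow_pos_of_pos hq0 s
  rw [dens2V, sub_zero, div_le_one (by positivity)]
  simpa [Measure.real] using hF q hq0.le hq1

lemma dens2V_one_right_le {s h H : ℝ} (hh : 0 < h) {F : Set ℝ}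
    (hF : InitialBound s (unitReflect F) H 0)
    {p : ℝ} (hp0 : 0 ≤ p) (hp1 : p < 1) : dens2V s h F p 1 ≤ H / h := by
  have hps := Real.rpow_pos_of_pos (sub_pos.2 hp1) s
  have := hF (1 - p) (by linarith) (by linarith)
  rw [← unitReflect_inter_Icc, measureReal_def, hausdorffMeasure_unitReflect, add_zero] at this
  rw [dens2V, div_le_div_iff₀ (by positivity) hh]
  nlinarith

lemma dens2V_zero_one {s h : ℝ} (hh : 0 < h) {F : Set ℝ} (hF : F ⊆ Set.Icc 0 1)
    (hFh : μH[s] F = ENNReal.ofReal h) : dens2V s h F 0 1 = 1 := by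
  rw [dens2V, Set.inter_eq_left.2 hF, hFh, ENNReal.toReal_ofReal hh.le, sub_zero,
    Real.one_rpow, mul_one, div_self hh.ne']

theorem stmt9
    (a gu b c gv d : ℝ)
    (ha : 0 < a) (hgu : 0 < gu) (hb : 0 < b) (hc : 0 < c) (hgv : 0 < gv) (hd : 0 < d)
    (hsum1 : a + gu + b = 1) (hsum2 : c + gv + d = 1)
    (Fu Fv : Set ℝ)
    (hFuc : IsCompact Fu) (hFvc : IsCompact Fv)
    (hFu0 : (0 : ℝ) ∈ Fu) (hFu1 : (1 : ℝ) ∈ Fu) (hFusub : Fu ⊆ Set.Icc 0 1)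
    (hFv0 : (0 : ℝ) ∈ Fv) (hFv1 : (1 : ℝ) ∈ Fv) (hFvsub : Fv ⊆ Set.Icc 0 1)
    (hFu : Fu = (fun x => a * x) '' Fu ∪ (fun x => b * x + (a + gu)) '' Fv)
    (hFv : Fv = (fun x => c * x) '' Fv ∪ (fun x => d * x + (c + gv)) '' Fu)
    (s : ℝ) (hs0 : 0 < s) (hs1 : s < 1)
    (hdim : (1 - a ^ s) * (1 - c ^ s) = b ^ s * d ^ s)
    (hu hv : ℝ) (hhu0 : 0 < hu) (hhv0 : 0 < hv)
    (hhuH : μH[s] Fu = ENNReal.ofReal hu) (hhvH : μH[s] Fv = ENNReal.ofReal hv)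
    (heigu : hu = a ^ s * hu + b ^ s * hv)
    (heigv : hv = d ^ s * hu + c ^ s * hv)
    (hcond2 : hv ≤ hu)
    (hcond3 : b * a ^ s ≤ (a + gu) * (1 - a ^ s))
    :
    IsGreatest {x : ℝ | ∃ p q : ℝ, Set.Icc (0 : ℝ) a ⊆ Set.Icc p q ∧
      Set.Icc p q ⊆ Set.Icc 0 1 ∧ x = dens2V s hu Fu p q} 1 ∧
    IsGreatest {x : ℝ | ∃ p q : ℝ, Set.Icc (0 : ℝ) c ⊆ Set.Icc p q ∧
      Set.Icc p q ⊆ Set.Icc 0 1 ∧ x = dens2V s hv Fv p q} 1 ∧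
    IsGreatest {x : ℝ | ∃ p q : ℝ, Set.Icc (a + gu) 1 ⊆ Set.Icc p q ∧
      Set.Icc p q ⊆ Set.Icc 0 1 ∧ x = dens2V s hu Fu p q} 1 ∧
    IsGreatest {x : ℝ | ∃ p q : ℝ, Set.Icc (c + gv) 1 ⊆ Set.Icc p q ∧
      Set.Icc p q ⊆ Set.Icc 0 1 ∧ x = dens2V s hv Fv p q} (hu / hv) := by
  have hα := Real.rpow_pos_of_pos ha s
  have hβ := Real.rpow_pos_of_pos hb s
  have hγ := Real.rpow_pos_of_pos hc s
  have hδ := Real.rpow_pos_of_pos hd s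
  have hα1 : a ^ s < 1 := Real.rpow_lt_one ha.le (by linarith) hs0
  have hβ1 : b ^ s < 1 := Real.rpow_lt_one hb.le (by linarith) hs0
  have hγ1 : c ^ s < 1 := Real.rpow_lt_one hc.le (by linarith) hs0
  have hδ1 : d ^ s < 1 := Real.rpow_lt_one hd.le (by linarith) hs0
  have hle_rpow : ∀ x : ℝ, 0 < x → x ≤ 1 → x ≤ x ^ s := fun x h0 h1 =>
    Real.self_le_rpow_of_le_one h0.le h1 hs1.le
  have haα := hle_rpow a ha (by linarith)
  have hcγ := hle_rpow c hc (by linarith)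
  have hdδ := hle_rpow d hd (by linarith)
  have hmu : (μH[s]).real Fu = hu := by
    rw [measureReal_def, hhuH, ENNReal.toReal_ofReal hhu0.le]
  have hmv : (μH[s]).real Fv = hv := by
    rw [measureReal_def, hhvH, ENNReal.toReal_ofReal hhv0.le]
  have hufin : μH[s] Fu ≠ ∞ := hhuH ▸ ENNReal.ofReal_ne_top
  have hvfin : μH[s] Fv ≠ ∞ := hhvH ▸ ENNReal.ofReal_ne_top
  have hγδ : c ^ s + d ^ s ≤ 1 := by
    have := mul_le_mul_of_nonneg_left hcond2 hδ.le
    refine le_of_mul_le_mul_right ?_ hhv0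
    linarith
  have hγd : c ^ s ≤ 1 - d := by linarith
  have hδc : d ^ s ≤ 1 - c := by linarith
  have hαb : a ^ s ≤ 1 - b := by
    rw [show a + gu = 1 - b by linarith] at hcond3
    linarith
  obtain ⟨ρ, hρ0, hρ1, hρα, hρβ, hρα', hργ, hρδ, hργ'⟩ : ∃ ρ : ℝ, 0 ≤ ρ ∧ ρ < 1 ∧ a ^ s ≤ ρ ∧
      b ^ s ≤ ρ ∧ 1 - a ^ s ≤ ρ ∧ c ^ s ≤ ρ ∧ d ^ s ≤ ρ ∧ 1 - c ^ s ≤ ρ := by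
    refine ⟨max (a ^ s) (max (b ^ s) (max (1 - a ^ s) (max (c ^ s) (max (d ^ s) (1 - c ^ s))))),
      ?_, ?_, ?_⟩
    · exact hα.le.trans (le_max_left _ _)
    · simp only [max_lt_iff]
      exact ⟨hα1, hβ1, by linarith, hγ1, hδ1, by linarith⟩
    · simp
  have hleft : InitialBound s Fu hu 0 ∧ InitialBound s Fv hv 0 := by
    refine InitialBound.zero_of_contraction hufin hvfin hmu.le hmv.le hρ0 hρ1 ?_
    intro ε hε hbu hbv
    constructor
    · refine InitialBound.union hs0 hs1 ha hgu hb hsum1 hFusub hFvsub hFu hufin hvfin hhu0 hρ0 hε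
        le_rfl hmu.le ?_ ?_ ?_ ?_ hbu hbv
      · rw [hmu]; linarith [mul_le_mul_of_nonneg_right hαb hhu0.le]
      · rw [hmu]; linarith
      · exact mul_le_mul_of_nonneg_right hρα hhu0.le
      · linarith [mul_le_mul_of_nonneg_right hρα' hhu0.le]
    · refine InitialBound.union hs0 hs1 hc hgv hd hsum2 hFvsub hFusub hFv hvfin hufin hhv0 hρ0 hε
        le_rfl hmv.le ?_ ?_ ?_ ?_ hbv hbu
      · rw [hmv]; linarith [mul_le_mul_of_nonneg_right hγd hhv0.le]
      · rw [hmv]; linarith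
      · exact mul_le_mul_of_nonneg_right hργ hhv0.le
      · linarith [mul_le_mul_of_nonneg_right hργ' hhv0.le]
  have hmu' : (μH[s]).real (unitReflect Fu) = hu := by
    rw [measureReal_def, hausdorffMeasure_unitReflect, ← measureReal_def, hmu]
  have hmv' : (μH[s]).real (unitReflect Fv) = hv := by
    rw [measureReal_def, hausdorffMeasure_unitReflect, ← measureReal_def, hmv]
  have hufin' : μH[s] (unitReflect Fu) ≠ ∞ := by rwa [hausdorffMeasure_unitReflect]
  have hvfin' : μH[s] (unitReflect Fv) ≠ ∞ := by rwa [hausdorffMeasure_unitReflect]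
  have hright : InitialBound s (unitReflect Fu) hu 0 ∧ InitialBound s (unitReflect Fv) hu 0 := by
    refine InitialBound.zero_of_contraction hufin' hvfin' hmu'.le (hmv'.le.trans hcond2)
      hρ0 hρ1 ?_
    intro ε hε hbu hbv
    constructor
    · refine InitialBound.union hs0 hs1 hb hgu ha (by linarith) (unitReflect_subset hFvsub)
        (unitReflect_subset hFusub) (unitReflect_eq_union hsum1 hFu) hvfin' hufin' hhu0 hρ0 hε
        le_rfl (hmv'.le.trans hcond2) ?_ ?_ ?_ ?_ hbv hbu
      · rw [hmv']; linarith [mul_le_mul_of_nonneg_right haα hhu0.le]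
      · rw [hmv']; linarith
      · exact mul_le_mul_of_nonneg_right hρβ hhu0.le
      · exact mul_le_mul_of_nonneg_right hρα hhu0.le
    · refine InitialBound.union hs0 hs1 hd hgv hc (by linarith) (unitReflect_subset hFusub)
        (unitReflect_subset hFvsub) (unitReflect_eq_union hsum2 hFv) hufin' hvfin' hhu0 hρ0 hε
        le_rfl hmu'.le ?_ ?_ ?_ ?_ hbu hbv
      · rw [hmu']; linarith [mul_le_mul_of_nonneg_right hδc hhu0.le]
      · rw [hmu']; linarith [mul_le_mul_of_nonneg_right hγδ hhu0.le]
      · exact mul_le_mul_of_nonneg_right hρδ hhu0.le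
      · exact mul_le_mul_of_nonneg_right hργ hhu0.le
  have hendsL : ∀ {k p q : ℝ}, 0 < k → Set.Icc 0 k ⊆ Set.Icc p q →
      Set.Icc p q ⊆ Set.Icc (0 : ℝ) 1 → p = 0 ∧ 0 < q ∧ q ≤ 1 := by
    intro k p q hk h1 h2
    have h3 := h1 (Set.left_mem_Icc.2 hk.le)
    have h4 := h1 (Set.right_mem_Icc.2 hk.le)
    have h5 := h2 (Set.left_mem_Icc.2 (h3.1.trans h3.2))
    have h6 := h2 (Set.right_mem_Icc.2 (h3.1.trans h3.2))
    exact ⟨le_antisymm h3.1 h5.1, hk.trans_le h4.2, h6.2⟩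
  have hendsR : ∀ {k p q : ℝ}, k < 1 → Set.Icc k 1 ⊆ Set.Icc p q →
      Set.Icc p q ⊆ Set.Icc (0 : ℝ) 1 → q = 1 ∧ 0 ≤ p ∧ p < 1 := by
    intro k p q hk h1 h2
    have h3 := h1 (Set.left_mem_Icc.2 hk.le)
    have h4 := h1 (Set.right_mem_Icc.2 hk.le)
    have h5 := h2 (Set.left_mem_Icc.2 (h3.1.trans h3.2))
    have h6 := h2 (Set.right_mem_Icc.2 (h3.1.trans h3.2))
    exact ⟨le_antisymm h6.2 h4.2, h5.1, h3.1.trans_lt hk⟩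
  refine ⟨⟨?_, ?_⟩, ⟨?_, ?_⟩, ⟨?_, ?_⟩, ⟨?_, ?_⟩⟩
  · exact ⟨0, 1, Set.Icc_subset_Icc_right (by linarith), le_rfl,
      (dens2V_zero_one hhu0 hFusub hhuH).symm⟩
  · rintro x ⟨p, q, h1, h2, rfl⟩
    obtain ⟨rfl, hq0, hq1⟩ := hendsL ha h1 h2
    exact dens2V_zero_left_le hhu0 hleft.1 hq0 hq1
  · exact ⟨0, 1, Set.Icc_subset_Icc_right (by linarith), le_rfl,
      (dens2V_zero_one hhv0 hFvsub hhvH).symm⟩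
  · rintro x ⟨p, q, h1, h2, rfl⟩
    obtain ⟨rfl, hq0, hq1⟩ := hendsL hc h1 h2
    exact dens2V_zero_left_le hhv0 hleft.2 hq0 hq1
  · exact ⟨0, 1, Set.Icc_subset_Icc_left (by linarith), le_rfl,
      (dens2V_zero_one hhu0 hFusub hhuH).symm⟩
  · rintro x ⟨p, q, h1, h2, rfl⟩
    obtain ⟨rfl, hp0, hp1⟩ := hendsR (by linarith) h1 h2
    exact (dens2V_one_right_le hhu0 hright.1 hp0 hp1).trans_eq (div_self hhu0.ne')
  · refine ⟨c + gv, 1, le_rfl, Set.Icc_subset_Icc_left (by linarith), ?_⟩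
    refine le_antisymm ?_ (dens2V_one_right_le hhv0 hright.2 (by linarith) (by linarith))
    obtain ⟨hfin, hle⟩ := hausdorffMeasure_real_affine_image_le hs0.le hc.le 0 hvfin
    have hincl : Fv ⊆ (fun x => c * x + 0) '' Fv ∪ Fv ∩ Set.Icc (c + gv) 1 := by
      intro z hz
      have hz' := hz
      rw [hFv] at hz'
      rcases hz' with ⟨y, hy, rfl⟩ | ⟨y, hy, rfl⟩
      · exact Or.inl ⟨y, hy, by simp⟩
      · refine Or.inr ⟨hz, ?_, (hFvsub hz).2⟩
        have := mul_nonneg hd.le (hFusub hy).1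
        simpa using this
    have h1 := measureReal_mono hincl (measure_union_ne_top hfin
      (ne_top_of_le_ne_top hvfin (measure_mono Set.inter_subset_left)))
    have h2 := measureReal_union_le (μ := μH[s]) ((fun x => c * x + 0) '' Fv)
      (Fv ∩ Set.Icc (c + gv) 1)
    rw [hmv] at h1 hle
    have h3 : d ^ s * hu ≤ (μH[s] (Fv ∩ Set.Icc (c + gv) 1)).toReal := by
      rw [← measureReal_def]
      linarith
    rw [dens2V, show 1 - (c + gv) = d by linarith, div_le_div_iff₀ hhv0 (by positivity)]
    nlinarith
  · rintro x ⟨p, q, h1, h2, rfl⟩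
    obtain ⟨rfl, hp0, hp1⟩ := hendsR (by linarith) h1 h2
    exact dens2V_one_right_le hhv0 hright.2 hp0 hp1
end

section
/- Let g_u, g_v, a, b, c be positive reals that are multiplicatively rationally independent. Then for every m ≥ 1, every n ≥ 0, all positive reals h₁, …, h_m and all positive reals x₁, …, x_n, the set g_u⟨1, a⟩ ∪ g_u b²⟨1, a, b², c⟩ ∪ g_v b⟨1, a, b², c⟩ is not equal to ⋃_{j=1}^{m} h_j⟨1, x₁, …, x_n⟩. -/
open MeasureTheory
open scoped ENNReal NNReal

def msemi {n : ℕ} (x : Fin n → ℝ) : Set ℝ :=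
  {z : ℝ | ∃ k : Fin n → ℕ, z = ∏ i, x i ^ k i}

def mcoset (y : ℝ) (S : Set ℝ) : Set ℝ := (fun z => y * z) '' S

/-- The Laurent monomial in five real numbers with the given integer exponents. -/
noncomputable def laurentMonomial (gu gv a b c : ℝ) (p q r s t : ℤ) : ℝ :=
  gu ^ p * gv ^ q * a ^ r * b ^ s * c ^ t

lemma laurentMonomial_mul {gu gv a b c : ℝ}
    (hgu : 0 < gu) (hgv : 0 < gv) (ha : 0 < a) (hb : 0 < b) (hc : 0 < c)
    (p q r s t p' q' r' s' t' : ℤ) :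
    laurentMonomial gu gv a b c p q r s t * laurentMonomial gu gv a b c p' q' r' s' t' =
      laurentMonomial gu gv a b c (p + p') (q + q') (r + r') (s + s') (t + t') := by
  simp only [laurentMonomial, zpow_add₀ hgu.ne', zpow_add₀ hgv.ne', zpow_add₀ ha.ne',
    zpow_add₀ hb.ne', zpow_add₀ hc.ne']
  ring

lemma laurentMonomial_inj {gu gv a b c : ℝ}
    (hgu : 0 < gu) (hgv : 0 < gv) (ha : 0 < a) (hb : 0 < b) (hc : 0 < c)
    (hind : ∀ m1 m2 m3 m4 m5 : ℤ,
      gu ^ m1 * gv ^ m2 * a ^ m3 * b ^ m4 * c ^ m5 = 1 →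
      m1 = 0 ∧ m2 = 0 ∧ m3 = 0 ∧ m4 = 0 ∧ m5 = 0)
    {p q r s t p' q' r' s' t' : ℤ}
    (h : laurentMonomial gu gv a b c p q r s t = laurentMonomial gu gv a b c p' q' r' s' t') :
    p = p' ∧ q = q' ∧ r = r' ∧ s = s' ∧ t = t' := by
  have key : laurentMonomial gu gv a b c (p + -p') (q + -q') (r + -r') (s + -s') (t + -t') = 1 := by
    rw [← laurentMonomial_mul hgu hgv ha hb hc, h, laurentMonomial_mul hgu hgv ha hb hc]
    simp [laurentMonomial]
  have := hind _ _ _ _ _ key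
  omega

lemma one_mem_msemi {n : ℕ} (x : Fin n → ℝ) : (1 : ℝ) ∈ msemi x :=
  ⟨0, by simp⟩

lemma mul_mem_msemi {n : ℕ} {x : Fin n → ℝ} {y z : ℝ} (hy : y ∈ msemi x) (hz : z ∈ msemi x) :
    y * z ∈ msemi x := by
  obtain ⟨k, rfl⟩ := hy
  obtain ⟨l, rfl⟩ := hz
  exact ⟨k + l, by simp [pow_add, Finset.prod_mul_distrib]⟩

lemma mul_mem_iUnion_mcoset {m n : ℕ} {h : Fin m → ℝ} {x : Fin n → ℝ} {w s : ℝ}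
    (hw : w ∈ ⋃ j : Fin m, mcoset (h j) (msemi x)) (hs : s ∈ msemi x) :
    w * s ∈ ⋃ j : Fin m, mcoset (h j) (msemi x) := by
  obtain ⟨j, t, ht, rfl⟩ := Set.mem_iUnion.1 hw
  exact Set.mem_iUnion.2 ⟨j, t * s, mul_mem_msemi ht hs, (mul_assoc _ _ _).symm⟩

lemma mem_union_mcoset_iff {gu gv a b c : ℝ} (hb : 0 < b) {z : ℝ} :
    z ∈ mcoset gu (msemi ![a]) ∪ mcoset (gu * b ^ 2) (msemi ![a, b ^ 2, c]) ∪
        mcoset (gv * b) (msemi ![a, b ^ 2, c]) ↔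
      (∃ i : ℕ, z = laurentMonomial gu gv a b c 1 0 i 0 0) ∨
      (∃ i j l : ℕ, z = laurentMonomial gu gv a b c 1 0 i (2 + 2 * j) l) ∨
      (∃ i j l : ℕ, z = laurentMonomial gu gv a b c 0 1 i (1 + 2 * j) l) := by
  have hA (i : ℕ) : laurentMonomial gu gv a b c 1 0 i 0 0 = gu * a ^ i := by
    simp [laurentMonomial]
  have hpow (j : ℕ) : b ^ (2 * (j : ℤ)) = (b ^ 2) ^ j := by
    rw [zpow_mul]
    norm_cast
  have hB (i j l : ℕ) : laurentMonomial gu gv a b c 1 0 i (2 + 2 * j) l =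
      gu * b ^ 2 * (a ^ i * (b ^ 2) ^ j * c ^ l) := by
    simp only [laurentMonomial, zpow_add₀ hb.ne', hpow, zpow_natCast, zpow_ofNat]
    ring
  have hC (i j l : ℕ) : laurentMonomial gu gv a b c 0 1 i (1 + 2 * j) l =
      gv * b * (a ^ i * (b ^ 2) ^ j * c ^ l) := by
    simp only [laurentMonomial, zpow_add₀ hb.ne', hpow, zpow_natCast, zpow_one, zpow_zero]
    ring
  simp only [hA, hB, hC]
  constructor
  · rintro ((⟨_, ⟨k, rfl⟩, rfl⟩ | ⟨_, ⟨k, rfl⟩, rfl⟩) | ⟨_, ⟨k, rfl⟩, rfl⟩)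
    · exact Or.inl ⟨k 0, by simp⟩
    · exact Or.inr (Or.inl ⟨k 0, k 1, k 2, by simp [Fin.prod_univ_three]⟩)
    · exact Or.inr (Or.inr ⟨k 0, k 1, k 2, by simp [Fin.prod_univ_three]⟩)
  · rintro (⟨i, rfl⟩ | ⟨i, j, l, rfl⟩ | ⟨i, j, l, rfl⟩)
    · exact Or.inl (Or.inl ⟨_, ⟨![i], rfl⟩, by simp⟩)
    · exact Or.inl (Or.inr ⟨_, ⟨![i, j, l], rfl⟩, by simp [Fin.prod_univ_three]⟩)
    · exact Or.inr ⟨_, ⟨![i, j, l], rfl⟩, by simp [Fin.prod_univ_three]⟩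

theorem stmt11 (gu gv a b c : ℝ)
    (hgu : 0 < gu) (hgv : 0 < gv) (ha : 0 < a) (hb : 0 < b) (hc : 0 < c)
    (hind : ∀ m1 m2 m3 m4 m5 : ℤ,
      gu ^ m1 * gv ^ m2 * a ^ m3 * b ^ m4 * c ^ m5 = 1 →
      m1 = 0 ∧ m2 = 0 ∧ m3 = 0 ∧ m4 = 0 ∧ m5 = 0)
    :
    ∀ (m n : ℕ), 1 ≤ m → ∀ (h : Fin m → ℝ) (x : Fin n → ℝ),
      (∀ j, 0 < h j) → (∀ k, 0 < x k) →
      mcoset gu (msemi ![a]) ∪ mcoset (gu * b ^ 2) (msemi ![a, b ^ 2, c]) ∪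
        mcoset (gv * b) (msemi ![a, b ^ 2, c]) ≠
      ⋃ j : Fin m, mcoset (h j) (msemi x) := by
  intro m n _ h x _ _ heq
  have hmul := laurentMonomial_mul hgu hgv ha hb hc
  have hinj {p q r s t p' q' r' s' t' : ℤ} :=
    laurentMonomial_inj (p := p) (q := q) (r := r) (s := s) (t := t) (p' := p') (q' := q')
      (r' := r') (s' := s') (t' := t') hgu hgv ha hb hc hind
  set W := mcoset gu (msemi ![a]) ∪ mcoset (gu * b ^ 2) (msemi ![a, b ^ 2, c]) ∪
    mcoset (gv * b) (msemi ![a, b ^ 2, c])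
  have hmem {z : ℝ} : z ∈ W ↔ _ := mem_union_mcoset_iff (gu := gu) (gv := gv) (a := a) (c := c) hb
  have hstab {w s : ℝ} (hw : w ∈ W) (hs : s ∈ msemi x) : w * s ∈ W := by
    rw [heq] at hw ⊢
    exact mul_mem_iUnion_mcoset hw hs
  have hh (j : Fin m) : h j ∈ W := by
    rw [heq]
    exact Set.mem_iUnion.2 ⟨j, 1, one_mem_msemi x, mul_one _⟩
  have hgu_mem : laurentMonomial gu gv a b c 1 0 0 0 0 ∈ W := hmem.2 (Or.inl ⟨0, by simp⟩)
  have hgv_mem (l : ℕ) : laurentMonomial gu gv a b c 0 1 0 1 l ∈ W :=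
    hmem.2 (Or.inr (Or.inr ⟨0, 0, l, by simp⟩))
  have hS {s : ℝ} (hs : s ∈ msemi x) :
      ∃ i j l : ℕ, s = laurentMonomial gu gv a b c 0 0 i j l ∧ (j = 0 → l = 0) := by
    have hquot {p q r u t : ℤ}
        (hz : laurentMonomial gu gv a b c 1 0 0 0 0 * s = laurentMonomial gu gv a b c p q r u t) :
        s = laurentMonomial gu gv a b c (-1 + p) q r u t := by
      have h1 := congrArg (laurentMonomial gu gv a b c (-1) 0 0 0 0 * ·) hz
      simp only [← mul_assoc, hmul] at h1
      simpa [laurentMonomial] using h1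
    rcases hmem.1 (hstab hgu_mem hs) with ⟨i, hz⟩ | ⟨i, j, l, hz⟩ | ⟨i, j, l, hz⟩
    · exact ⟨i, 0, 0, by simpa using hquot hz, fun _ => rfl⟩
    · exact ⟨i, 2 + 2 * j, l, by simpa using hquot hz, by omega⟩
    · have hw := hmem.1 (hstab (hgv_mem 0) hs)
      rw [hquot hz, hmul] at hw
      rcases hw with ⟨i', hw⟩ | ⟨i', j', l', hw⟩ | ⟨i', j', l', hw⟩ <;>
      · have := hinj hw
        omega
  have hcover (l : ℕ) : ∃ j : Fin m, ∃ i : ℕ, h j = laurentMonomial gu gv a b c 0 1 i 1 l := by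
    have hl := hgv_mem l
    rw [heq] at hl
    obtain ⟨j, s, hs, hjs⟩ := Set.mem_iUnion.1 hl
    refine ⟨j, ?_⟩
    obtain ⟨i, k, t, rfl, hkt⟩ := hS hs
    rcases hmem.1 (hh j) with ⟨i', hz⟩ | ⟨i', j', l', hz⟩ | ⟨i', j', l', hz⟩ <;>
      simp only [hz, hmul] at hjs <;> have hexp := hinj hjs
    · omega
    · omega
    · obtain rfl : j' = 0 := by omega
      obtain rfl : l' = l := by omega
      exact ⟨i', by simpa using hz⟩
  choose f i hf using hcover
  obtain ⟨l, l', hne, hfl⟩ := Finite.exists_ne_map_eq_of_infinite f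
  have hll := hf l
  rw [hfl, hf l'] at hll
  have := hinj hll
  omega
end

section
/- For the 2-vertex IFS on the unit interval with b = d, if g_u, g_v, a, b, c are multiplicatively rationally independent, then the attractor F_u is not the attractor of any standard (1-vertex) IFS on ℝ satisfying the convex strong separation condition: there do not exist n ≥ 2 and contracting similarities T₁, …, T_n : ℝ → ℝ such that F_u = ⋃_{i=1}^{n} T_i(F_u) and the intervals T_i([0,1]), 1 ≤ i ≤ n, are pairwise disjoint (note [0,1] is the convex hull of F_u). -/
open MeasureTheory
open scoped ENNReal NNReal

/-- `ℓ` is the length of a bounded complementary interval of `F` with endpoints in `F`. -/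
def IsGapLength (F : Set ℝ) (ℓ : ℝ) : Prop :=
  ∃ x ∈ F, ∃ y ∈ F, x < y ∧ (∀ z ∈ F, x < z → z < y → False) ∧ ℓ = y - x

section TwoPieces

variable {F A B : Set ℝ} {p g q : ℝ}

theorem isGapLength_middle (hp : 0 < p) (hg : 0 < g) (hq : 0 < q)
    (hA1 : (1 : ℝ) ∈ A) (hA : A ⊆ Set.Icc 0 1) (hB0 : (0 : ℝ) ∈ B) (hB : B ⊆ Set.Icc 0 1)
    (hF : F = (fun x => p * x) '' A ∪ (fun x => q * x + (p + g)) '' B) : IsGapLength F g := by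
  subst hF
  refine ⟨p, Or.inl ⟨1, hA1, by simp⟩, p + g, Or.inr ⟨0, hB0, by simp⟩, by linarith, ?_, by ring⟩
  rintro z (⟨w, hw, rfl⟩ | ⟨w, hw, rfl⟩) h1 h2
  · have := (hA hw).2
    dsimp only at h1
    nlinarith
  · have := (hB hw).1
    dsimp only at h2
    nlinarith

theorem IsGapLength.left (hp : 0 < p) (hg : 0 < g) (hq : 0 < q)
    (hA : A ⊆ Set.Icc 0 1) (hB : B ⊆ Set.Icc 0 1)
    (hF : F = (fun x => p * x) '' A ∪ (fun x => q * x + (p + g)) '' B) {ℓ : ℝ}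
    (h : IsGapLength A ℓ) : IsGapLength F (p * ℓ) := by
  subst hF
  obtain ⟨x, hx, y, hy, hxy, hgap, rfl⟩ := h
  refine ⟨p * x, Or.inl ⟨x, hx, rfl⟩, p * y, Or.inl ⟨y, hy, rfl⟩, by gcongr, ?_, by ring⟩
  rintro z (⟨w, hw, rfl⟩ | ⟨w, hw, rfl⟩) h1 h2
  · exact hgap w hw (lt_of_mul_lt_mul_left h1 hp.le) (lt_of_mul_lt_mul_left h2 hp.le)
  · have := (hB hw).1
    have := (hA hy).2
    dsimp only at h2
    nlinarith

theorem IsGapLength.right (hp : 0 < p) (hg : 0 < g) (hq : 0 < q)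
    (hA : A ⊆ Set.Icc 0 1) (hB : B ⊆ Set.Icc 0 1)
    (hF : F = (fun x => p * x) '' A ∪ (fun x => q * x + (p + g)) '' B) {ℓ : ℝ}
    (h : IsGapLength B ℓ) : IsGapLength F (q * ℓ) := by
  subst hF
  obtain ⟨x, hx, y, hy, hxy, hgap, rfl⟩ := h
  refine ⟨q * x + (p + g), Or.inr ⟨x, hx, rfl⟩, q * y + (p + g), Or.inr ⟨y, hy, rfl⟩,
    by gcongr, ?_, by ring⟩
  rintro z (⟨w, hw, rfl⟩ | ⟨w, hw, rfl⟩) h1 h2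
  · have := (hA hw).2
    have := (hB hx).1
    dsimp only at h1
    nlinarith
  · dsimp only at h1 h2
    exact hgap w hw (lt_of_mul_lt_mul_left (by linarith) hq.le)
      (lt_of_mul_lt_mul_left (by linarith) hq.le)

theorem IsGapLength.cases (hp : 0 < p) (hg : 0 < g) (hq : 0 < q)
    (hA1 : (1 : ℝ) ∈ A) (hA : A ⊆ Set.Icc 0 1) (hB0 : (0 : ℝ) ∈ B) (hB : B ⊆ Set.Icc 0 1)
    (hF : F = (fun x => p * x) '' A ∪ (fun x => q * x + (p + g)) '' B) {ℓ : ℝ}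
    (h : IsGapLength F ℓ) :
    ℓ = g ∨ (∃ ℓ', IsGapLength A ℓ' ∧ ℓ = p * ℓ') ∨ ∃ ℓ', IsGapLength B ℓ' ∧ ℓ = q * ℓ' := by
  subst hF
  obtain ⟨x, hx, y, hy, hxy, hgap, rfl⟩ := h
  rcases hx with ⟨x, hx, rfl⟩ | ⟨x, hx, rfl⟩ <;> rcases hy with ⟨y, hy, rfl⟩ | ⟨y, hy, rfl⟩ <;>
    dsimp only at hxy hgap ⊢
  · refine Or.inr (Or.inl ⟨y - x, ⟨x, hx, y, hy, lt_of_mul_lt_mul_left hxy hp.le, ?_, rfl⟩,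
      by ring⟩)
    intro z hz h1 h2
    exact hgap (p * z) (Or.inl ⟨z, hz, rfl⟩) (by gcongr) (by gcongr)
  · left
    have hx1 := (hA hx).2
    have hy0 := (hB hy).1
    have h1 := hgap p (Or.inl ⟨1, hA1, by simp⟩)
    have h2 := hgap (p + g) (Or.inr ⟨0, hB0, by simp⟩)
    have h3 : p * x = p := by
      by_contra hne
      exact h1 (lt_of_le_of_ne (by nlinarith) hne) (by nlinarith)
    have h4 : p + g = q * y + (p + g) := by
      by_contra hne
      exact h2 (by nlinarith) (lt_of_le_of_ne (by nlinarith) hne)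
    linarith
  · have := (hA hy).2
    have := (hB hx).1
    nlinarith
  · refine Or.inr (Or.inr ⟨y - x, ⟨x, hx, y, hy,
      lt_of_mul_lt_mul_left (by linarith) hq.le, ?_, rfl⟩, by ring⟩)
    intro z hz h1 h2
    exact hgap (q * z + (p + g)) (Or.inr ⟨z, hz, rfl⟩) (by gcongr) (by gcongr)

end TwoPieces

theorem IsGapLength.pos {F : Set ℝ} {ℓ : ℝ} (h : IsGapLength F ℓ) : 0 < ℓ := by
  obtain ⟨x, -, y, -, hxy, -, rfl⟩ := h
  linarith

theorem IsGapLength.le_one {F : Set ℝ} (hF : F ⊆ Set.Icc 0 1) {ℓ : ℝ}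
    (h : IsGapLength F ℓ) : ℓ ≤ 1 := by
  obtain ⟨x, hx, y, hy, -, -, rfl⟩ := h
  linarith [(hF hx).1, (hF hy).2]

/-- Products of `g` and edge ratios along closed walks at the first vertex, and products of `h`
and edge ratios along walks from the first vertex to the second; `s`, `t` are the ratios of the
loops, and `b` is the ratio of both connecting edges. -/
def IsWalkMonomial (g h s b t ℓ : ℝ) : Prop :=
  (∃ i j k : ℕ, (j = 0 → k = 0) ∧ ℓ = g * s ^ i * b ^ (2 * j) * t ^ k) ∨
    ∃ i j k : ℕ, ℓ = h * s ^ i * b ^ (2 * j + 1) * t ^ k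

section WalkMonomial

variable {g h s b t ℓ : ℝ}

theorem isWalkMonomial_self : IsWalkMonomial g h s b t g :=
  Or.inl ⟨0, 0, 0, by simp, by simp⟩

theorem IsWalkMonomial.loop (hℓ : IsWalkMonomial g h s b t ℓ) :
    IsWalkMonomial g h s b t (s * ℓ) := by
  rcases hℓ with ⟨i, j, k, hjk, rfl⟩ | ⟨i, j, k, rfl⟩
  · exact Or.inl ⟨i + 1, j, k, hjk, by ring⟩
  · exact Or.inr ⟨i + 1, j, k, by ring⟩

theorem IsWalkMonomial.cross (hℓ : IsWalkMonomial h g t b s ℓ) :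
    IsWalkMonomial g h s b t (b * ℓ) := by
  rcases hℓ with ⟨i, j, k, -, rfl⟩ | ⟨i, j, k, rfl⟩
  · exact Or.inr ⟨k, j, i, by ring⟩
  · exact Or.inl ⟨k, j + 1, i, by simp, by ring⟩

end WalkMonomial

theorem isWalkMonomial_of_isGapLength {U V : Set ℝ} {a g b c h : ℝ}
    (ha : 0 < a) (hg : 0 < g) (hb : 0 < b) (hc : 0 < c) (hh : 0 < h)
    (hsum1 : a + g + b = 1) (hsum2 : c + h + b = 1)
    (hU0 : (0 : ℝ) ∈ U) (hU1 : (1 : ℝ) ∈ U) (hUsub : U ⊆ Set.Icc 0 1)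
    (hV0 : (0 : ℝ) ∈ V) (hV1 : (1 : ℝ) ∈ V) (hVsub : V ⊆ Set.Icc 0 1)
    (hU : U = (fun x => a * x) '' U ∪ (fun x => b * x + (a + g)) '' V)
    (hV : V = (fun x => c * x) '' V ∪ (fun x => b * x + (c + h)) '' U)
    {ℓ : ℝ} (hℓ : IsGapLength U ℓ) : IsWalkMonomial g h a b c ℓ := by
  obtain ⟨M, hM0, hM1, haM, hbM, hcM⟩ : ∃ M : ℝ, 0 < M ∧ M < 1 ∧ a ≤ M ∧ b ≤ M ∧ c ≤ M :=
    ⟨max a (max b c), by simp [ha], by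
      refine max_lt (by linarith) (max_lt (by linarith) (by linarith)), by simp, by simp, by simp⟩
  have shrink : ∀ {r ℓ' : ℝ} (n : ℕ), r ≤ M → 0 < ℓ' → M ^ (n + 1) < r * ℓ' → M ^ n < ℓ' := by
    intro r ℓ' n hr hpos hlt
    refine lt_of_mul_lt_mul_left ?_ hM0.le
    calc M * M ^ n = M ^ (n + 1) := by ring
      _ < r * ℓ' := hlt
      _ ≤ M * ℓ' := by gcongr
  have key : ∀ n : ℕ,
      (∀ ℓ, IsGapLength U ℓ → M ^ n < ℓ → IsWalkMonomial g h a b c ℓ) ∧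
      (∀ ℓ, IsGapLength V ℓ → M ^ n < ℓ → IsWalkMonomial h g c b a ℓ) := by
    intro n
    induction n with
    | zero =>
      refine ⟨fun ℓ hℓ hlt => ?_, fun ℓ hℓ hlt => ?_⟩
      · linarith [hℓ.le_one hUsub, pow_zero M]
      · linarith [hℓ.le_one hVsub, pow_zero M]
    | succ n ih =>
      refine ⟨fun ℓ hℓ hlt => ?_, fun ℓ hℓ hlt => ?_⟩
      · rcases hℓ.cases ha hg hb hU1 hUsub hV0 hVsub hU with rfl | ⟨m, hm, rfl⟩ | ⟨m, hm, rfl⟩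
        · exact isWalkMonomial_self
        · exact (ih.1 m hm (shrink n haM hm.pos hlt)).loop
        · exact (ih.2 m hm (shrink n hbM hm.pos hlt)).cross
      · rcases hℓ.cases hc hh hb hV1 hVsub hU0 hUsub hV with rfl | ⟨m, hm, rfl⟩ | ⟨m, hm, rfl⟩
        · exact isWalkMonomial_self
        · exact (ih.2 m hm (shrink n hcM hm.pos hlt)).loop
        · exact (ih.1 m hm (shrink n hbM hm.pos hlt)).cross
  obtain ⟨n, hn⟩ := exists_pow_lt_of_lt_one hℓ.pos hM1
  exact (key n).1 ℓ hℓ hn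

/-- A multiplicatively independent family has at most one representation of a number as a
monomial. -/
theorem exponents_eq_of_monomial_eq {x y a b c : ℝ}
    (hx : 0 < x) (hy : 0 < y) (ha : 0 < a) (hb : 0 < b) (hc : 0 < c)
    (hind : ∀ m1 m2 m3 m4 m5 : ℤ,
      x ^ m1 * y ^ m2 * a ^ m3 * b ^ m4 * c ^ m5 = 1 →
      m1 = 0 ∧ m2 = 0 ∧ m3 = 0 ∧ m4 = 0 ∧ m5 = 0)
    {e1 e2 e3 e4 e5 f1 f2 f3 f4 f5 : ℕ}
    (h : x ^ e1 * y ^ e2 * a ^ e3 * b ^ e4 * c ^ e5 =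
      x ^ f1 * y ^ f2 * a ^ f3 * b ^ f4 * c ^ f5) :
    e1 = f1 ∧ e2 = f2 ∧ e3 = f3 ∧ e4 = f4 ∧ e5 = f5 := by
  have := hind (e1 - f1) (e2 - f2) (e3 - f3) (e4 - f4) (e5 - f5) (by
    rw [zpow_sub₀ hx.ne', zpow_sub₀ hy.ne', zpow_sub₀ ha.ne', zpow_sub₀ hb.ne', zpow_sub₀ hc.ne']
    simp only [zpow_natCast]
    field_simp
    linarith)
  omega

section Similarities

variable {ι : Type*} {F : Set ℝ} {T : ι → ℝ → ℝ} {r : ι → ℝ}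

theorem continuous_of_abs_sub_eq {f : ℝ → ℝ} {ρ : ℝ}
    (hf : ∀ x y, |f x - f y| = ρ * |x - y|) : Continuous f := by
  refine (LipschitzWith.of_dist_le_mul (K := ρ.toNNReal) fun x y => ?_).continuous
  rw [Real.dist_eq, Real.dist_eq, hf]
  gcongr
  exact Real.le_coe_toNNReal ρ

theorem between_of_abs_sub_eq {f : ℝ → ℝ} {ρ : ℝ} (hρ : 0 < ρ)
    (hf : ∀ x y, |f x - f y| = ρ * |x - y|) {x y z : ℝ} (hxz : x < z) (hzy : z < y) :
    (f x < f z ∧ f z < f y) ∨ (f y < f z ∧ f z < f x) := by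
  have h1 := hf x z
  have h2 := hf z y
  have h3 := hf x y
  rw [abs_of_neg (by linarith : x - z < 0)] at h1
  rw [abs_of_neg (by linarith : z - y < 0)] at h2
  rw [abs_of_neg (by linarith : x - y < 0)] at h3
  have p1 : 0 < ρ * -(x - z) := mul_pos hρ (by linarith)
  have p2 : 0 < ρ * -(z - y) := mul_pos hρ (by linarith)
  have p3 : ρ * -(x - y) = ρ * -(x - z) + ρ * -(z - y) := by ring
  rcases abs_cases (f x - f z) with h | h <;> rcases abs_cases (f z - f y) with h' | h' <;>
    rcases abs_cases (f x - f y) with h'' | h'' <;>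
    first
      | (left; constructor <;> linarith)
      | (right; constructor <;> linarith)

theorem IsGapLength.image (hFsub : F ⊆ Set.Icc 0 1) (hr : ∀ i, 0 < r i)
    (hT : ∀ i x y, |T i x - T i y| = r i * |x - y|) (hF : F = ⋃ i, T i '' F)
    (hdisj : ∀ i j, i ≠ j → Disjoint (T i '' Set.Icc (0 : ℝ) 1) (T j '' Set.Icc (0 : ℝ) 1))
    (i : ι) {ℓ : ℝ} (h : IsGapLength F ℓ) : IsGapLength F (r i * ℓ) := by
  obtain ⟨x, hx, y, hy, hxy, hgap, rfl⟩ := h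
  have hmem : ∀ w ∈ F, T i w ∈ F := fun w hw => by
    rw [hF]
    exact Set.mem_iUnion.2 ⟨i, w, hw, rfl⟩
  have hinner : ∀ z ∈ F, z ∈ Set.uIcc (T i x) (T i y) → z ≠ T i x → z ≠ T i y → False := by
    intro z hz hzI hzx hzy
    obtain ⟨t, ht, rfl⟩ := intermediate_value_uIcc
      ((continuous_of_abs_sub_eq (hT i)).continuousOn) hzI
    rw [Set.uIcc_of_le hxy.le] at ht
    rw [hF] at hz
    obtain ⟨j, w, hw, hwt⟩ := Set.mem_iUnion.1 hz
    have hij : i = j := by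
      by_contra hne
      exact Set.disjoint_left.1 (hdisj i j hne)
        ⟨t, ⟨(hFsub hx).1.trans ht.1, ht.2.trans (hFsub hy).2⟩, rfl⟩ ⟨w, hFsub hw, hwt⟩
    subst hij
    have hwt' : w = t := by
      have := hT i w t
      rw [hwt, sub_self, abs_zero] at this
      have := (mul_eq_zero.1 this.symm).resolve_left (hr i).ne'
      exact sub_eq_zero.1 (abs_eq_zero.1 this)
    subst hwt'
    exact hgap w hw (lt_of_le_of_ne ht.1 (by rintro rfl; exact hzx rfl))
      (lt_of_le_of_ne ht.2 (by rintro rfl; exact hzy rfl))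
  have hlen := hT i x y
  rw [abs_of_neg (by linarith : x - y < 0)] at hlen
  have hpos : 0 < r i * -(x - y) := mul_pos (hr i) (by linarith)
  rcases lt_or_ge (T i x) (T i y) with hlt | hge
  · refine ⟨T i x, hmem x hx, T i y, hmem y hy, hlt, fun z hz h1 h2 => ?_, ?_⟩
    · exact hinner z hz (Set.mem_uIcc.2 (Or.inl ⟨h1.le, h2.le⟩)) h1.ne' h2.ne
    · rw [abs_of_neg (by linarith)] at hlen
      linarith
  · rw [abs_of_nonneg (by linarith)] at hlen
    refine ⟨T i y, hmem y hy, T i x, hmem x hx, by linarith, fun z hz h1 h2 => ?_, by linarith⟩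
    exact hinner z hz (Set.mem_uIcc.2 (Or.inr ⟨h1.le, h2.le⟩)) h2.ne h1.ne'

theorem IsGapLength.exists_eq_mul (hFsub : F ⊆ Set.Icc 0 1) (hr : ∀ i, 0 < r i)
    (hT : ∀ i x y, |T i x - T i y| = r i * |x - y|) (hF : F = ⋃ i, T i '' F)
    {ℓ : ℝ} (h : IsGapLength F ℓ)
    (hsep : ∀ i j, i ≠ j → ∀ x ∈ Set.Icc (0 : ℝ) 1, ∀ y ∈ Set.Icc (0 : ℝ) 1,
      ℓ < |T i x - T j y|) :
    ∃ i ℓ', IsGapLength F ℓ' ∧ ℓ = r i * ℓ' := by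
  obtain ⟨x, hx, y, hy, hxy, hgap, rfl⟩ := h
  have hmem : ∀ i, ∀ w ∈ F, T i w ∈ F := fun i w hw => by
    rw [hF]
    exact Set.mem_iUnion.2 ⟨i, w, hw, rfl⟩
  rw [hF] at hx hy
  obtain ⟨i, s, hs, rfl⟩ := Set.mem_iUnion.1 hx
  obtain ⟨j, t, ht, rfl⟩ := Set.mem_iUnion.1 hy
  have hij : i = j := by
    by_contra hne
    have := hsep i j hne s (hFsub hs) t (hFsub ht)
    rw [abs_of_neg (by linarith)] at this
    linarith
  subst hij
  have hlen := hT i s t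
  rw [abs_of_neg (by linarith)] at hlen
  rcases lt_trichotomy s t with hst | rfl | hst
  · rw [abs_of_neg (by linarith)] at hlen
    refine ⟨i, t - s, ⟨s, hs, t, ht, hst, fun z hz h1 h2 => ?_, rfl⟩, by linarith⟩
    rcases between_of_abs_sub_eq (hr i) (hT i) h1 h2 with h | h
    · exact hgap _ (hmem i z hz) h.1 h.2
    · linarith
  · exact absurd hxy (lt_irrefl _)
  · rw [abs_of_pos (by linarith)] at hlen
    refine ⟨i, s - t, ⟨t, ht, s, hs, hst, fun z hz h1 h2 => ?_, rfl⟩, by linarith⟩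
    rcases between_of_abs_sub_eq (hr i) (hT i) h1 h2 with h | h
    · linarith
    · exact hgap _ (hmem i z hz) h.1 h.2

theorem eventually_forall_lt_abs_sub [Finite ι]
    (hT : ∀ i x y, |T i x - T i y| = r i * |x - y|)
    (hdisj : ∀ i j, i ≠ j → Disjoint (T i '' Set.Icc (0 : ℝ) 1) (T j '' Set.Icc (0 : ℝ) 1))
    {f : ℕ → ℝ} (hf : Filter.Tendsto f Filter.atTop (nhds 0)) :
    ∀ᶠ k in Filter.atTop, ∀ i j, i ≠ j → ∀ x ∈ Set.Icc (0 : ℝ) 1, ∀ y ∈ Set.Icc (0 : ℝ) 1,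
      f k < |T i x - T j y| := by
  simp only [Filter.eventually_all]
  intro i j hij
  have hK : ∀ i, IsCompact (T i '' Set.Icc (0 : ℝ) 1) := fun i =>
    isCompact_Icc.image (continuous_of_abs_sub_eq (hT i))
  obtain ⟨δ, hδ, hlt⟩ := Metric.exists_pos_forall_lt_edist (hK i) (hK j).isClosed (hdisj i j hij)
  filter_upwards [hf.eventually (gt_mem_nhds (NNReal.coe_pos.2 hδ))] with k hk x hx y hy
  have := hlt (T i x) ⟨x, hx, rfl⟩ (T j y) ⟨y, hy, rfl⟩
  rw [edist_nndist, ENNReal.coe_lt_coe, ← NNReal.coe_lt_coe, coe_nndist, Real.dist_eq] at this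
  exact hk.trans this

end Similarities

theorem stmt12
    (a gu b c gv d : ℝ)
    (ha : 0 < a) (hgu : 0 < gu) (hb : 0 < b) (hc : 0 < c) (hgv : 0 < gv) (hd : 0 < d)
    (hsum1 : a + gu + b = 1) (hsum2 : c + gv + d = 1)
    (Fu Fv : Set ℝ)
    (hFuc : IsCompact Fu) (hFvc : IsCompact Fv)
    (hFu0 : (0 : ℝ) ∈ Fu) (hFu1 : (1 : ℝ) ∈ Fu) (hFusub : Fu ⊆ Set.Icc 0 1)
    (hFv0 : (0 : ℝ) ∈ Fv) (hFv1 : (1 : ℝ) ∈ Fv) (hFvsub : Fv ⊆ Set.Icc 0 1)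
    (hFu : Fu = (fun x => a * x) '' Fu ∪ (fun x => b * x + (a + gu)) '' Fv)
    (hFv : Fv = (fun x => c * x) '' Fv ∪ (fun x => d * x + (c + gv)) '' Fu)
    (hbd : b = d)
    (hind : ∀ m1 m2 m3 m4 m5 : ℤ,
      gu ^ m1 * gv ^ m2 * a ^ m3 * b ^ m4 * c ^ m5 = 1 →
      m1 = 0 ∧ m2 = 0 ∧ m3 = 0 ∧ m4 = 0 ∧ m5 = 0)
    :
    ¬ ∃ (n : ℕ) (T : Fin n → ℝ → ℝ) (rT : Fin n → ℝ),
      2 ≤ n ∧ (∀ i, 0 < rT i ∧ rT i < 1) ∧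
      (∀ i x y, |T i x - T i y| = rT i * |x - y|) ∧
      Fu = ⋃ i, T i '' Fu ∧
      (∀ i j, i ≠ j → Disjoint (T i '' Set.Icc (0 : ℝ) 1) (T j '' Set.Icc (0 : ℝ) 1)) := by
  rintro ⟨n, T, r, -, hr, hT, hF, hdisj⟩
  subst hbd
  have hmono : ∀ {ℓ}, IsGapLength Fu ℓ → IsWalkMonomial gu gv a b c ℓ :=
    isWalkMonomial_of_isGapLength ha hgu hb hc hgv hsum1 hsum2 hFu0 hFu1 hFusub
      hFv0 hFv1 hFvsub hFu hFv
  have hr0 : ∀ i, 0 < r i := fun i => (hr i).1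
  have hratio : ∀ i, ∃ p q s : ℕ, (q = 0 → s = 0) ∧ r i = a ^ p * b ^ (2 * q) * c ^ s := by
    intro i
    have hg1 := (isGapLength_middle ha hgu hb hFu1 hFusub hFv0 hFvsub hFu).image
      hFusub hr0 hT hF hdisj i
    have hg2 := hg1.image hFusub hr0 hT hF hdisj i
    rcases hmono hg1 with ⟨p, q, s, hqs, h⟩ | ⟨p, q, s, h⟩
    · exact ⟨p, q, s, hqs, mul_left_cancel₀ hgu.ne' (by linarith)⟩
    · exfalso
      have hsq : gu * (r i * (r i * gu)) =
          gu ^ 0 * gv ^ 2 * a ^ (2 * p) * b ^ (2 * (2 * q + 1)) * c ^ (2 * s) := by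
        rw [show gu * (r i * (r i * gu)) = (r i * gu) ^ 2 by ring, h]
        ring
      rcases hmono hg2 with ⟨p', q', s', -, h'⟩ | ⟨p', q', s', h'⟩
      · have := exponents_eq_of_monomial_eq hgu hgv ha hb hc hind (e1 := 2) (e2 := 0) (e3 := p')
          (e4 := 2 * q') (e5 := s') (Eq.trans (by rw [h']; ring) hsq)
        omega
      · have := exponents_eq_of_monomial_eq hgu hgv ha hb hc hind (e1 := 1) (e2 := 1) (e3 := p')
          (e4 := 2 * q' + 1) (e5 := s') (Eq.trans (by rw [h']; ring) hsq)
        omega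
  have hgapv : ∀ k : ℕ, IsGapLength Fv (c ^ k * gv) := by
    intro k
    induction k with
    | zero =>
      simpa using isGapLength_middle hc hgv hb hFv1 hFvsub hFu0 hFusub hFv
    | succ k ih =>
      rw [show c ^ (k + 1) * gv = c * (c ^ k * gv) by ring]
      exact ih.left hc hgv hb hFvsub hFusub hFv
  have htend : Filter.Tendsto (fun k : ℕ => b * (c ^ k * gv)) Filter.atTop (nhds 0) := by
    simpa using ((tendsto_pow_atTop_nhds_zero_of_lt_one hc.le (by linarith)).mul_const gv).const_mul b
  obtain ⟨k, hk⟩ := (eventually_forall_lt_abs_sub hT hdisj htend).exists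
  obtain ⟨i, ℓ, hℓ, heq⟩ := ((hgapv k).right ha hgu hb hFusub hFvsub hFu).exists_eq_mul
    hFusub hr0 hT hF hk
  obtain ⟨p, q, s, hqs, hri⟩ := hratio i
  rcases hmono hℓ with ⟨p', q', s', -, h'⟩ | ⟨p', q', s', h'⟩
  · have := exponents_eq_of_monomial_eq hgu hgv ha hb hc hind
      (e1 := 0) (e2 := 1) (e3 := 0) (e4 := 1) (e5 := k)
      (f1 := 1) (f2 := 0) (f3 := p + p') (f4 := 2 * q + 2 * q') (f5 := s + s')
      (Eq.trans (by ring) (heq.trans (by rw [hri, h']; ring)))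
    omega
  · have := exponents_eq_of_monomial_eq hgu hgv ha hb hc hind
      (e1 := 0) (e2 := 1) (e3 := 0) (e4 := 1) (e5 := k)
      (f1 := 0) (f2 := 1) (f3 := p + p') (f4 := 2 * q + (2 * q' + 1)) (f5 := s + s')
      (Eq.trans (by ring) (heq.trans (by rw [hri, h']; ring)))
    obtain rfl : p = 0 := by omega
    obtain rfl : q = 0 := by omega
    obtain rfl : s = 0 := hqs rfl
    have := (hr i).2
    simp [hri] at this
end

section
/- For the 2-vertex IFS on the unit interval, the set G_u of gap lengths of the attractor F_u — that is, the set of lengths of the connected components of [0,1] \ F_u (each such component is a bounded open interval, since 0, 1 ∈ F_u and F_u is closed) — is given by G_u = g_u⟨1, a⟩ ∪ g_u·bd·⟨1, a, bd, c⟩ ∪ g_v·b·⟨1, a, bd, c⟩. -/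
open MeasureTheory
open scoped ENNReal NNReal

/-- The lengths of the bounded complementary intervals of `F`. -/
def gapLengths (F : Set ℝ) : Set ℝ :=
  {x : ℝ | ∃ p q : ℝ, p ∈ F ∧ q ∈ F ∧ p < q ∧ Set.Ioo p q ∩ F = ∅ ∧ x = q - p}

theorem mem_mcoset_msemi_one {y a x : ℝ} :
    x ∈ mcoset y (msemi ![a]) ↔ ∃ i : ℕ, x = y * a ^ i := by
  simp only [mcoset, msemi, Set.mem_image, Set.mem_ofPred_eq]
  constructor
  · rintro ⟨z, ⟨k, rfl⟩, rfl⟩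
    exact ⟨k 0, by simp⟩
  · rintro ⟨i, rfl⟩
    exact ⟨_, ⟨![i], rfl⟩, by simp⟩

theorem mem_mcoset_msemi_three {y a e c x : ℝ} :
    x ∈ mcoset y (msemi ![a, e, c]) ↔ ∃ i j k : ℕ, x = y * (a ^ i * e ^ j * c ^ k) := by
  simp only [mcoset, msemi, Set.mem_image, Set.mem_ofPred_eq]
  constructor
  · rintro ⟨z, ⟨k, rfl⟩, rfl⟩
    exact ⟨k 0, k 1, k 2, by simp [Fin.prod_univ_three]⟩
  · rintro ⟨i, j, k, rfl⟩
    exact ⟨_, ⟨![i, j, k], rfl⟩, by simp [Fin.prod_univ_three]⟩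

theorem gapLengths_subset_Ioc {F : Set ℝ} (hF : F ⊆ Set.Icc 0 1) :
    gapLengths F ⊆ Set.Ioc 0 1 := by
  rintro x ⟨p, q, hp, hq, hpq, -, rfl⟩
  have h1 := hF hp
  have h2 := hF hq
  exact ⟨by linarith, by linarith [h1.1, h2.2]⟩

/-- Gap lengths of a set made of a scaled copy of `F`, a gap of length `g`, and a scaled copy
of `E`. -/
theorem mem_gapLengths_iff {s g t : ℝ} (hs : 0 < s) (hg : 0 < g) (ht : 0 < t)
    {F E : Set ℝ} (hF1 : (1 : ℝ) ∈ F) (hF : F ⊆ Set.Icc 0 1)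
    (hE0 : (0 : ℝ) ∈ E) (hE : E ⊆ Set.Icc 0 1)
    (h : F = (fun x => s * x) '' F ∪ (fun x => t * x + (s + g)) '' E) (x : ℝ) :
    x ∈ gapLengths F ↔
      x = g ∨ (∃ y ∈ gapLengths F, x = s * y) ∨ ∃ y ∈ gapLengths E, x = t * y := by
  have hl : ∀ z ∈ F, s * z ∈ F := fun z hz => by rw [h]; exact Or.inl ⟨z, hz, rfl⟩
  have hr : ∀ z ∈ E, t * z + (s + g) ∈ F := fun z hz => by rw [h]; exact Or.inr ⟨z, hz, rfl⟩
  have hc : ∀ z ∈ F, (∃ y ∈ F, z = s * y) ∨ ∃ y ∈ E, z = t * y + (s + g) := fun z hz => by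
    rw [h] at hz
    rcases hz with ⟨y, hy, rfl⟩ | ⟨y, hy, rfl⟩
    · exact Or.inl ⟨y, hy, rfl⟩
    · exact Or.inr ⟨y, hy, rfl⟩
  have hls : ∀ z ∈ F, s * z ≤ s := fun z hz => by nlinarith [(hF hz).2]
  have hrs : ∀ z ∈ E, s + g ≤ t * z + (s + g) := fun z hz => by nlinarith [(hE hz).1]
  have hsF : s ∈ F := by simpa using hl 1 hF1
  have hsgF : s + g ∈ F := by simpa using hr 0 hE0
  constructor
  · rintro ⟨p, q, hp, hq, hpq, hemp, rfl⟩
    have hno : ∀ z ∈ F, p < z → z < q → False := fun z hz h1 h2 =>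
      Set.eq_empty_iff_forall_notMem.1 hemp z ⟨⟨h1, h2⟩, hz⟩
    rcases hc p hp with ⟨p', hp', rfl⟩ | ⟨p', hp', rfl⟩ <;>
      rcases hc q hq with ⟨q', hq', rfl⟩ | ⟨q', hq', rfl⟩
    · refine Or.inr (Or.inl ⟨q' - p', ⟨p', q', hp', hq', lt_of_mul_lt_mul_left hpq hs.le, ?_, rfl⟩,
        by ring⟩)
      refine Set.eq_empty_iff_forall_notMem.2 fun z ⟨⟨h1, h2⟩, hz⟩ => hno _ (hl z hz) ?_ ?_
      · exact mul_lt_mul_of_pos_left h1 hs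
      · exact mul_lt_mul_of_pos_left h2 hs
    · have h1 := hls p' hp'
      have h2 := hrs q' hq'
      have h3 : s ≤ s * p' := not_lt.1 fun hlt => hno s hsF hlt (by linarith)
      have h4 : t * q' + (s + g) ≤ s + g := not_lt.1 fun hlt => hno _ hsgF (by linarith) hlt
      exact Or.inl (by linarith)
    · linarith [hrs p' hp', hls q' hq']
    · refine Or.inr (Or.inr ⟨q' - p', ⟨p', q', hp', hq', lt_of_mul_lt_mul_left (a := t)
        (by linarith) ht.le, ?_, rfl⟩, by ring⟩)
      refine Set.eq_empty_iff_forall_notMem.2 fun z ⟨⟨h1, h2⟩, hz⟩ => hno _ (hr z hz) ?_ ?_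
      · linarith [mul_lt_mul_of_pos_left h1 ht]
      · linarith [mul_lt_mul_of_pos_left h2 ht]
  · rintro (rfl | ⟨y, ⟨p, q, hp, hq, hpq, hemp, rfl⟩, rfl⟩ |
      ⟨y, ⟨p, q, hp, hq, hpq, hemp, rfl⟩, rfl⟩)
    · refine ⟨s, s + x, hsF, hsgF, by linarith, ?_, by ring⟩
      refine Set.eq_empty_iff_forall_notMem.2 fun z ⟨⟨h1, h2⟩, hz⟩ => ?_
      rcases hc z hz with ⟨w, hw, rfl⟩ | ⟨w, hw, rfl⟩
      · linarith [hls w hw]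
      · linarith [hrs w hw]
    · refine ⟨s * p, s * q, hl p hp, hl q hq, mul_lt_mul_of_pos_left hpq hs, ?_, by ring⟩
      refine Set.eq_empty_iff_forall_notMem.2 fun z ⟨⟨h1, h2⟩, hz⟩ => ?_
      rcases hc z hz with ⟨w, hw, rfl⟩ | ⟨w, hw, rfl⟩
      · exact Set.eq_empty_iff_forall_notMem.1 hemp w
          ⟨⟨lt_of_mul_lt_mul_left h1 hs.le, lt_of_mul_lt_mul_left h2 hs.le⟩, hw⟩
      · linarith [hrs w hw, hls q hq]
    · refine ⟨t * p + (s + g), t * q + (s + g), hr p hp, hr q hq,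
        by linarith [mul_lt_mul_of_pos_left hpq ht], ?_, by ring⟩
      refine Set.eq_empty_iff_forall_notMem.2 fun z ⟨⟨h1, h2⟩, hz⟩ => ?_
      rcases hc z hz with ⟨w, hw, rfl⟩ | ⟨w, hw, rfl⟩
      · linarith [hrs p hp, hls w hw]
      · exact Set.eq_empty_iff_forall_notMem.1 hemp w
          ⟨⟨lt_of_mul_lt_mul_left (a := t) (by linarith) ht.le,
            lt_of_mul_lt_mul_left (a := t) (by linarith) ht.le⟩, hw⟩

/-- The set of weights of directed paths from the first vertex to either gap. -/
def pathGaps (a g b c h d : ℝ) : Set ℝ :=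
  mcoset g (msemi ![a]) ∪ mcoset (g * (b * d)) (msemi ![a, b * d, c]) ∪
    mcoset (h * b) (msemi ![a, b * d, c])

theorem mem_pathGaps {a g b c h d x : ℝ} :
    x ∈ pathGaps a g b c h d ↔ ((∃ i : ℕ, x = g * a ^ i) ∨
      ∃ i j k : ℕ, x = g * (b * d) * (a ^ i * (b * d) ^ j * c ^ k)) ∨
      ∃ i j k : ℕ, x = h * b * (a ^ i * (b * d) ^ j * c ^ k) := by
  simp only [pathGaps, Set.mem_union, mem_mcoset_msemi_one, mem_mcoset_msemi_three]

theorem self_mem_pathGaps {a g b c h d : ℝ} : g ∈ pathGaps a g b c h d :=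
  mem_pathGaps.2 (Or.inl (Or.inl ⟨0, by simp⟩))

theorem loop_mul_mem_pathGaps {a g b c h d y : ℝ} (hy : y ∈ pathGaps a g b c h d) :
    a * y ∈ pathGaps a g b c h d := by
  rw [mem_pathGaps] at hy ⊢
  rcases hy with (⟨i, rfl⟩ | ⟨i, j, k, rfl⟩) | ⟨i, j, k, rfl⟩
  · exact Or.inl (Or.inl ⟨i + 1, by ring⟩)
  · exact Or.inl (Or.inr ⟨i + 1, j, k, by ring⟩)
  · exact Or.inr ⟨i + 1, j, k, by ring⟩

theorem cross_mul_mem_pathGaps {a g b c h d y : ℝ} (hy : y ∈ pathGaps c h d a g b) :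
    b * y ∈ pathGaps a g b c h d := by
  rw [mem_pathGaps] at hy ⊢
  rcases hy with (⟨i, rfl⟩ | ⟨i, j, k, rfl⟩) | ⟨i, j, k, rfl⟩
  · exact Or.inr ⟨0, 0, i, by ring⟩
  · exact Or.inr ⟨k, j + 1, i, by ring⟩
  · exact Or.inl (Or.inr ⟨k, j, i, by ring⟩)

theorem pow_mul_mem_of_mul_mem {r : ℝ} {S : Set ℝ} (hS : ∀ y ∈ S, r * y ∈ S) (n : ℕ) :
    ∀ y ∈ S, r ^ n * y ∈ S := by
  induction n with
  | zero => intro y hy; simpa using hy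
  | succ n ih =>
    intro y hy
    have := hS _ (ih y hy)
    rwa [← mul_assoc, ← pow_succ'] at this

theorem pathGaps_subset {a g b c h d : ℝ} {U V : Set ℝ}
    (hg : g ∈ U) (ha : ∀ y ∈ U, a * y ∈ U) (hb : ∀ y ∈ V, b * y ∈ U)
    (hh : h ∈ V) (hc : ∀ y ∈ V, c * y ∈ V) (hd : ∀ y ∈ U, d * y ∈ V) :
    pathGaps a g b c h d ⊆ U := by
  have hbd : ∀ y ∈ U, b * d * y ∈ U := fun y hy => by
    rw [mul_assoc]; exact hb _ (hd y hy)
  have key : ∀ i j k : ℕ, ∀ y ∈ V, a ^ i * ((b * d) ^ j * (b * (c ^ k * y))) ∈ U :=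
    fun i j k y hy => pow_mul_mem_of_mul_mem ha i _ (pow_mul_mem_of_mul_mem hbd j _
      (hb _ (pow_mul_mem_of_mul_mem hc k y hy)))
  intro x hx
  rcases mem_pathGaps.1 hx with (⟨i, rfl⟩ | ⟨i, j, k, rfl⟩) | ⟨i, j, k, rfl⟩
  · rw [mul_comm]; exact pow_mul_mem_of_mul_mem ha i g hg
  · convert key i j k _ (hd g hg) using 1; ring
  · convert key i j k _ hh using 1; ring

theorem subset_pathGaps {a g b c h d r : ℝ} (hr0 : 0 < r) (hr1 : r < 1)
    (har : a ≤ r) (hbr : b ≤ r) (hcr : c ≤ r) (hdr : d ≤ r) {U V : Set ℝ}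
    (hU : U ⊆ Set.Ioc 0 1) (hV : V ⊆ Set.Ioc 0 1)
    (hU' : ∀ x ∈ U, x = g ∨ (∃ y ∈ U, x = a * y) ∨ ∃ y ∈ V, x = b * y)
    (hV' : ∀ x ∈ V, x = h ∨ (∃ y ∈ V, x = c * y) ∨ ∃ y ∈ U, x = d * y) :
    U ⊆ pathGaps a g b c h d := by
  have descend : ∀ {s y : ℝ} {n : ℕ}, s ≤ r → 0 < y → r ^ (n + 1) < s * y → r ^ n < y := by
    intro s y n hs hy hlt
    refine lt_of_mul_lt_mul_left (a := r) ?_ hr0.le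
    rw [← pow_succ']
    exact hlt.trans_le (mul_le_mul_of_nonneg_right hs hy.le)
  have key : ∀ n : ℕ, ∀ x, r ^ n < x →
      (x ∈ U → x ∈ pathGaps a g b c h d) ∧ (x ∈ V → x ∈ pathGaps c h d a g b) := by
    intro n
    induction n with
    | zero =>
      intro x hx
      rw [pow_zero] at hx
      exact ⟨fun hxU => absurd (hU hxU).2 (not_le.2 hx),
        fun hxV => absurd (hV hxV).2 (not_le.2 hx)⟩
    | succ n ih =>
      intro x hx
      constructor
      · intro hxU
        rcases hU' x hxU with rfl | ⟨y, hy, rfl⟩ | ⟨y, hy, rfl⟩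
        · exact self_mem_pathGaps
        · exact loop_mul_mem_pathGaps ((ih y (descend har (hU hy).1 hx)).1 hy)
        · exact cross_mul_mem_pathGaps ((ih y (descend hbr (hV hy).1 hx)).2 hy)
      · intro hxV
        rcases hV' x hxV with rfl | ⟨y, hy, rfl⟩ | ⟨y, hy, rfl⟩
        · exact self_mem_pathGaps
        · exact loop_mul_mem_pathGaps ((ih y (descend hcr (hV hy).1 hx)).2 hy)
        · exact cross_mul_mem_pathGaps ((ih y (descend hdr (hU hy).1 hx)).1 hy)
  intro x hx
  obtain ⟨n, hn⟩ := exists_pow_lt_of_lt_one (hU hx).1 hr1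
  exact (key n x hn).1 hx

theorem stmt13
    (a gu b c gv d : ℝ)
    (ha : 0 < a) (hgu : 0 < gu) (hb : 0 < b) (hc : 0 < c) (hgv : 0 < gv) (hd : 0 < d)
    (hsum1 : a + gu + b = 1) (hsum2 : c + gv + d = 1)
    (Fu Fv : Set ℝ)
    (hFuc : IsCompact Fu) (hFvc : IsCompact Fv)
    (hFu0 : (0 : ℝ) ∈ Fu) (hFu1 : (1 : ℝ) ∈ Fu) (hFusub : Fu ⊆ Set.Icc 0 1)
    (hFv0 : (0 : ℝ) ∈ Fv) (hFv1 : (1 : ℝ) ∈ Fv) (hFvsub : Fv ⊆ Set.Icc 0 1)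
    (hFu : Fu = (fun x => a * x) '' Fu ∪ (fun x => b * x + (a + gu)) '' Fv)
    (hFv : Fv = (fun x => c * x) '' Fv ∪ (fun x => d * x + (c + gv)) '' Fu)
    :
    {x : ℝ | ∃ p q : ℝ, p ∈ Fu ∧ q ∈ Fu ∧ p < q ∧ Set.Ioo p q ∩ Fu = ∅ ∧ x = q - p} =
      mcoset gu (msemi ![a]) ∪ mcoset (gu * (b * d)) (msemi ![a, b * d, c]) ∪
        mcoset (gv * b) (msemi ![a, b * d, c]) := by
  change gapLengths Fu = pathGaps a gu b c gv d
  have hU := mem_gapLengths_iff ha hgu hb hFu1 hFusub hFv0 hFvsub hFu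
  have hV := mem_gapLengths_iff hc hgv hd hFv1 hFvsub hFu0 hFusub hFv
  apply Set.Subset.antisymm
  · refine subset_pathGaps (r := max (max a b) (max c d)) (by simp [ha]) ?_
      (by simp) (by simp) (by simp) (by simp) (gapLengths_subset_Ioc hFusub)
      (gapLengths_subset_Ioc hFvsub) (fun x => (hU x).1) (fun x => (hV x).1)
    simp only [max_lt_iff]
    exact ⟨⟨by linarith, by linarith⟩, by linarith, by linarith⟩
  · exact pathGaps_subset ((hU _).2 (Or.inl rfl))
      (fun y hy => (hU _).2 (Or.inr (Or.inl ⟨y, hy, rfl⟩)))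
      (fun y hy => (hU _).2 (Or.inr (Or.inr ⟨y, hy, rfl⟩)))
      ((hV _).2 (Or.inl rfl))
      (fun y hy => (hV _).2 (Or.inr (Or.inl ⟨y, hy, rfl⟩)))
      (fun y hy => (hV _).2 (Or.inr (Or.inr ⟨y, hy, rfl⟩)))
end

section
/- For all real numbers x, z > 0, y ≥ 0 and 0 < p < 1, one has (x + y + z)^p < (x + y)^p + (y + z)^p − y^p. -/
open MeasureTheory
open scoped ENNReal NNReal

/-- A strictly concave function has strictly decreasing increments. -/
theorem StrictConcaveOn.add_lt_add_of_pos {s : Set ℝ} {f : ℝ → ℝ} (hf : StrictConcaveOn ℝ s f)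
    {x y z : ℝ} (hx : 0 < x) (hz : 0 < z) (hy : y ∈ s) (hxyz : x + y + z ∈ s) :
    f (x + y + z) + f y < f (x + y) + f (y + z) := by
  have hne : x + y + z ≠ y := by linarith
  have hxz : x + z ≠ 0 := by positivity
  have hsum : x / (x + z) + z / (x + z) = 1 := by field_simp
  have h₁ := hf.2 hxyz hy hne (by positivity : 0 < x / (x + z))
    (by positivity : 0 < z / (x + z)) hsum
  have h₂ := hf.2 hxyz hy hne (by positivity : 0 < z / (x + z))
    (by positivity : 0 < x / (x + z)) (by rw [add_comm, hsum])
  simp only [smul_eq_mul] at h₁ h₂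
  have e₁ : x / (x + z) * (x + y + z) + z / (x + z) * y = x + y := by field_simp; ring
  have e₂ : z / (x + z) * (x + y + z) + x / (x + z) * y = y + z := by field_simp; ring
  rw [e₁] at h₁
  rw [e₂] at h₂
  linear_combination h₁ + h₂ - (f (x + y + z) + f y) * hsum

theorem stmt16 (x y z p : ℝ) (hx : 0 < x) (hy : 0 ≤ y) (hz : 0 < z)
    (hp0 : 0 < p) (hp1 : p < 1) :
    (x + y + z) ^ p < (x + y) ^ p + (y + z) ^ p - y ^ p :=
  lt_sub_iff_add_lt.mpr <| (Real.strictConcaveOn_rpow hp0 hp1).add_lt_add_of_pos hx hz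
    (Set.mem_Ici.mpr hy) (Set.mem_Ici.mpr (by positivity))
end
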